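/- arXiv:2008.09989 — 3 statements merged into one kernel-verified Lean document; each statement's English description precedes it below -/
import Mathlib

section
/- Let N ≥ 1 and let f : ℝ → ℝ be continuously differentiable with f(0) = 0, and suppose there exists δ > 0 such that f'(s) ≤ 0 for all s with |s| ≤ δ. If u : ℝ^N → ℝ is a classical solution of Δu + f(u) = 0 in ℝ^N which is localized (u(x) → 0 as |x| → ∞) and stable (for every smooth compactly supported φ : ℝ^N → ℝ one has ∫_{ℝ^N} (|∇φ(x)|² − f'(u(x)) φ(x)²) dx ≥ 0), then u is identically zero. -/
open MeasureTheory Filter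

/-- The Laplacian of `u : ℝ^N → ℝ`: the sum of the second pure partial derivatives. -/
noncomputable def coordLaplacian {N : ℕ} (u : EuclideanSpace ℝ (Fin N) → ℝ)
    (x : EuclideanSpace ℝ (Fin N)) : ℝ :=
  ∑ i : Fin N,
    fderiv ℝ (fun y => fderiv ℝ u y (EuclideanSpace.single i 1)) x (EuclideanSpace.single i 1)

open Topology Metric

section Gradient

variable {E : Type*} [NormedAddCommGroup E] [InnerProductSpace ℝ E] [CompleteSpace E]

theorem HasGradientAt.mul_real {φ ψ : E → ℝ} {p q x : E} (hφ : HasGradientAt φ p x)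
    (hψ : HasGradientAt ψ q x) :
    HasGradientAt (fun y => φ y * ψ y) (φ x • q + ψ x • p) x := by
  rw [hasGradientAt_iff_hasFDerivAt] at *
  rw [map_add, map_smul, map_smul]
  exact hφ.mul hψ

theorem HasGradientAt.add_real {φ ψ : E → ℝ} {p q x : E} (hφ : HasGradientAt φ p x)
    (hψ : HasGradientAt ψ q x) :
    HasGradientAt (fun y => φ y + ψ y) (p + q) x := by
  rw [hasGradientAt_iff_hasFDerivAt] at *
  rw [map_add]
  exact hφ.add hψ

theorem HasDerivAt.comp_hasGradientAt {g : ℝ → ℝ} {φ : E → ℝ} {g' : ℝ} {p x : E}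
    (hg : HasDerivAt g g' (φ x)) (hφ : HasGradientAt φ p x) :
    HasGradientAt (fun y => g (φ y)) (g' • p) x := by
  rw [hasGradientAt_iff_hasFDerivAt] at *
  rw [map_smul]
  exact hg.comp_hasFDerivAt x hφ

theorem ContDiff.hasGradientAt_real {φ : E → ℝ} (hφ : ContDiff ℝ 1 φ) (x : E) :
    HasGradientAt φ (gradient φ x) x :=
  ((hφ.differentiable one_ne_zero) x).hasGradientAt

theorem ContDiff.continuous_gradient {φ : E → ℝ} (hφ : ContDiff ℝ 1 φ) :
    Continuous (gradient φ) :=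
  (InnerProductSpace.toDual ℝ E).symm.continuous.comp (hφ.continuous_fderiv one_ne_zero)

theorem gradient_eq_zero_of_notMem_tsupport {φ : E → ℝ} {x : E} (hx : x ∉ tsupport φ) :
    gradient φ x = 0 := by
  have : fderiv ℝ φ x = 0 := by
    by_contra h
    exact hx (support_fderiv_subset ℝ h)
  simp [gradient, this]

theorem gradient_eq_zero_of_eqOn {φ : E → ℝ} {s : Set E} {c : ℝ} (hs : IsOpen s)
    (h : ∀ y ∈ s, φ y = c) {x : E} (hx : x ∈ s) : gradient φ x = 0 := by
  have h1 : φ =ᶠ[𝓝 x] fun _ => c := by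
    filter_upwards [hs.mem_nhds hx] with y hy using h y hy
  rw [h1.gradient_eq, gradient_fun_const]

theorem inner_gradient_eq_fderiv (φ : E → ℝ) (x e : E) :
    inner ℝ (gradient φ x) e = fderiv ℝ φ x e := inner_gradient_left

theorem norm_gradient (φ : E → ℝ) (x : E) : ‖gradient φ x‖ = ‖fderiv ℝ φ x‖ := by
  simp [gradient]

end Gradient

section Mollify

variable {E : Type*} [NormedAddCommGroup E] [InnerProductSpace ℝ E] [FiniteDimensional ℝ E]
  [MeasurableSpace E] [BorelSpace E]

theorem exists_contDiff_uniform_approx {φ : E → ℝ} (hφ : ContDiff ℝ 1 φ)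
    (hc : HasCompactSupport φ) {ε : ℝ} (hε : 0 < ε) :
    ∃ ψ : E → ℝ, ContDiff ℝ (⊤ : ℕ∞) ψ ∧ tsupport ψ ⊆ cthickening 1 (tsupport φ) ∧
      (∀ x, |ψ x - φ x| ≤ ε) ∧ ∀ x, ‖gradient ψ x - gradient φ x‖ ≤ ε := by
  have hcd : HasCompactSupport (fderiv ℝ φ) := hc.fderiv ℝ
  have hcont : Continuous (fderiv ℝ φ) := hφ.continuous_fderiv one_ne_zero
  obtain ⟨r₁, hr₁, h₁⟩ := Metric.uniformContinuous_iff.1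
    (hc.uniformContinuous_of_continuous hφ.continuous) ε hε
  obtain ⟨r₂, hr₂, h₂⟩ := Metric.uniformContinuous_iff.1
    (hcd.uniformContinuous_of_continuous hcont) ε hε
  set r := min 1 (min r₁ r₂) with hr
  have hr0 : 0 < r := by positivity
  let ρ : ContDiffBump (0 : E) := ⟨r / 2, r, by positivity, by linarith⟩
  let ψ : E → ℝ := convolution (ρ.normed volume) φ (ContinuousLinearMap.lsmul ℝ ℝ) volume
  have hloc : LocallyIntegrable φ volume := hφ.continuous.locallyIntegrable
  have hρc : HasCompactSupport (ρ.normed (volume : Measure E)) := ρ.hasCompactSupport_normed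
  have hψ : ∀ x, HasFDerivAt ψ
      (convolution (ρ.normed volume) (fderiv ℝ φ) (ContinuousLinearMap.lsmul ℝ ℝ) volume x) x := by
    intro x
    exact hc.hasFDerivAt_convolution_right (ContinuousLinearMap.lsmul ℝ ℝ)
      (ρ.continuous_normed.locallyIntegrable) hφ x
  refine ⟨ψ, ?_, ?_, ?_, ?_⟩
  · exact hρc.contDiff_convolution_left _ ρ.contDiff_normed hloc
  · refine closure_minimal ?_ isClosed_cthickening
    refine (support_convolution_subset _).trans ?_
    rintro _ ⟨a, ha, b, hb, rfl⟩
    have ha' : a ∈ ball (0 : E) r := by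
      have := ρ.support_normed_eq (μ := volume)
      rw [this] at ha
      exact ha
    refine mem_cthickening_of_dist_le _ b _ _ (subset_tsupport _ hb) ?_
    have : ‖a‖ < r := by simpa using ha'
    have h1 : r ≤ 1 := min_le_left _ _
    simp only [dist_eq_norm, add_sub_cancel_right]
    linarith
  · intro x
    have := ρ.dist_normed_convolution_le (μ := volume) (g := φ) (x₀ := x) (ε := ε)
      hφ.continuous.aestronglyMeasurable (fun y hy => (h₁ (lt_of_lt_of_le hy
        ((min_le_right _ _).trans (min_le_left _ _)))).le)
    simpa [Real.dist_eq] using this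
  · intro x
    have := ρ.dist_normed_convolution_le (μ := volume) (g := fderiv ℝ φ) (x₀ := x) (ε := ε)
      hcont.aestronglyMeasurable (fun y hy => (h₂ (lt_of_lt_of_le hy
        ((min_le_right _ _).trans (min_le_right _ _)))).le)
    rw [dist_eq_norm, ← (hψ x).fderiv] at this
    simpa only [gradient, ← map_sub, LinearIsometryEquiv.norm_map] using this

/-- First-order integral functionals extend by density from smooth to `C¹` test functions. -/
theorem exists_seq_contDiff_tendsto_integral {φ : E → ℝ} (hφ : ContDiff ℝ 1 φ)
    (hc : HasCompactSupport φ) :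
    ∃ ψ : ℕ → E → ℝ, (∀ n, ContDiff ℝ (⊤ : ℕ∞) (ψ n)) ∧ (∀ n, HasCompactSupport (ψ n)) ∧
      ∀ F : E × ℝ × E → ℝ, Continuous F → (∀ x, F (x, 0, 0) = 0) →
        Tendsto (fun n => ∫ x, F (x, ψ n x, gradient (ψ n) x)) atTop
          (𝓝 (∫ x, F (x, φ x, gradient φ x))) := by
  have hpos : ∀ n : ℕ, 0 < 1 / ((n : ℝ) + 1) := fun n => Nat.one_div_pos_of_nat
  choose ψ hψs hψt hψ hψg using fun n : ℕ => exists_contDiff_uniform_approx hφ hc (hpos n)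
  have hK : IsCompact (cthickening 1 (tsupport φ)) := hc.isCompact.cthickening
  have hle : ∀ n : ℕ, 1 / ((n : ℝ) + 1) ≤ 1 := fun n => by
    rw [div_le_one (by positivity)]; linarith [n.cast_nonneg (α := ℝ)]
  refine ⟨ψ, hψs, fun n => HasCompactSupport.of_support_subset_isCompact hK
    ((subset_tsupport _).trans (hψt n)), fun F hF hF0 => ?_⟩
  set K := cthickening 1 (tsupport φ)
  obtain ⟨A, hA⟩ := hc.exists_bound_of_continuous hφ.continuous
  have hcg : HasCompactSupport (gradient φ) := by
    refine HasCompactSupport.intro hc.isCompact fun x hx => gradient_eq_zero_of_notMem_tsupport hx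
  obtain ⟨B, hB⟩ := hcg.exists_bound_of_continuous hφ.continuous_gradient
  obtain ⟨M, hM⟩ := (hK.prod ((isCompact_closedBall (0 : ℝ) (A + 1)).prod
    (isCompact_closedBall (0 : E) (B + 1)))).exists_bound_of_continuousOn hF.continuousOn
  have hψ1 : ∀ n, ContDiff ℝ 1 (ψ n) := fun n => (hψs n).of_le (by exact_mod_cast le_top)
  refine tendsto_integral_of_dominated_convergence (K.indicator fun _ => M) ?_ ?_ ?_ ?_
  · intro n
    exact (hF.comp (continuous_id.prodMk ((hψ1 n).continuous.prodMk
      (hψ1 n).continuous_gradient))).aestronglyMeasurable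
  · rw [integrable_indicator_iff hK.measurableSet]
    exact integrableOn_const hK.measure_lt_top.ne
  · intro n
    refine Eventually.of_forall fun x => ?_
    by_cases hx : x ∈ K
    · rw [Set.indicator_of_mem hx]
      refine hM _ ⟨hx, ?_, ?_⟩
      · have h1 := hψ n x
        have h2 := hA x
        rw [Real.norm_eq_abs] at h2
        have h3 : |ψ n x| ≤ |ψ n x - φ x| + |φ x| := by
          simpa using abs_add_le (ψ n x - φ x) (φ x)
        simp only [mem_closedBall, dist_zero_right, Real.norm_eq_abs]
        linarith [hle n]
      · have h1 := hψg n x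
        have h2 := hB x
        have h3 : ‖gradient (ψ n) x‖ ≤ ‖gradient (ψ n) x - gradient φ x‖ + ‖gradient φ x‖ := by
          simpa using norm_add_le (gradient (ψ n) x - gradient φ x) (gradient φ x)
        simp only [mem_closedBall, dist_zero_right]
        linarith [hle n]
    · have hx' : x ∉ tsupport (ψ n) := fun h => hx (hψt n h)
      rw [Set.indicator_of_notMem hx, image_eq_zero_of_notMem_tsupport hx',
        gradient_eq_zero_of_notMem_tsupport hx', hF0, norm_zero]
  · refine Eventually.of_forall fun x => ?_
    refine (hF.tendsto _).comp (tendsto_const_nhds.prodMk_nhds (Tendsto.prodMk_nhds ?_ ?_))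
    · exact tendsto_iff_norm_sub_tendsto_zero.2 (squeeze_zero (fun _ => norm_nonneg _)
        (fun n => hψ n x) tendsto_one_div_add_atTop_nhds_zero_nat)
    · exact tendsto_iff_norm_sub_tendsto_zero.2 (squeeze_zero (fun _ => norm_nonneg _)
        (fun n => hψg n x) tendsto_one_div_add_atTop_nhds_zero_nat)

end Mollify

/-- `G` is a positive convex approximation of `s ↦ max s 0` at scale `ε`, with derivative `G'`,
and `H'` is the derivative of `G * G'`. -/
structure IsSmoothPosPart (ε : ℝ) (G G' H' : ℝ → ℝ) : Prop where
  hasDerivAt : ∀ s, HasDerivAt G (G' s) s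
  hasDerivAt_mul : ∀ s, HasDerivAt (fun s => G s * G' s) (H' s) s
  continuous_deriv : Continuous G'
  continuous_deriv_mul : Continuous H'
  sq_le : ∀ s, G' s ^ 2 ≤ H' s
  pos : ∀ s, 0 < G s
  deriv_nonneg : ∀ s, 0 ≤ G' s
  deriv_le_one : ∀ s, G' s ≤ 1
  abs_sub_le : ∀ s, |s * G' s - G s| ≤ ε
  self_le : ∀ s, s ≤ G s
  le_abs_add : ∀ s, G s ≤ |s| + ε
  le_of_nonpos : ∀ s ≤ 0, G s ≤ ε

theorem exists_isSmoothPosPart {ε : ℝ} (hε : 0 < ε) :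
    ∃ G G' H' : ℝ → ℝ, IsSmoothPosPart ε G G' H' := by
  have hq : ∀ s : ℝ, 0 < √(s ^ 2 + ε ^ 2) := fun s => Real.sqrt_pos.2 (by positivity)
  have hq2 : ∀ s : ℝ, √(s ^ 2 + ε ^ 2) ^ 2 = s ^ 2 + ε ^ 2 :=
    fun s => Real.sq_sqrt (by positivity)
  have hqs : ∀ s : ℝ, |s| ≤ √(s ^ 2 + ε ^ 2) := fun s => Real.abs_le_sqrt (by nlinarith)
  have hqε : ∀ s : ℝ, ε ≤ √(s ^ 2 + ε ^ 2) := fun s => Real.le_sqrt_of_sq_le (by nlinarith)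
  have hqle : ∀ s : ℝ, √(s ^ 2 + ε ^ 2) ≤ |s| + ε := fun s => by
    rw [Real.sqrt_le_left (by positivity), ← sq_abs s]
    nlinarith [abs_nonneg s]
  have hqd : ∀ s : ℝ, HasDerivAt (fun s : ℝ => √(s ^ 2 + ε ^ 2)) (s / √(s ^ 2 + ε ^ 2)) s := by
    intro s
    have h := (((hasDerivAt_id s).pow 2).add_const (ε ^ 2)).sqrt
      (by simp only [id, Pi.pow_apply]; positivity)
    convert h using 1
    have := (hq s).ne'
    simp only [id, Pi.pow_apply]
    field_simp
    norm_num
    field_simp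
  have hqc : Continuous fun s : ℝ => √(s ^ 2 + ε ^ 2) := by fun_prop
  have hd : ∀ s : ℝ, HasDerivAt (fun s : ℝ => (s + √(s ^ 2 + ε ^ 2)) / 2)
      ((1 + s / √(s ^ 2 + ε ^ 2)) / 2) s := fun s => ((hasDerivAt_id s).add (hqd s)).div_const 2
  have hd2 : ∀ s : ℝ, HasDerivAt (fun s : ℝ => (1 + s / √(s ^ 2 + ε ^ 2)) / 2)
      (ε ^ 2 / √(s ^ 2 + ε ^ 2) ^ 3 / 2) s := by
    intro s
    refine ((((hasDerivAt_id s).div (hqd s) (hq s).ne').const_add 1).div_const 2).congr_deriv ?_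
    have := (hq s).ne'
    simp only [id]
    field_simp
    linarith [hq2 s]
  refine ⟨fun s => (s + √(s ^ 2 + ε ^ 2)) / 2, fun s => (1 + s / √(s ^ 2 + ε ^ 2)) / 2,
    fun s => (1 + s / √(s ^ 2 + ε ^ 2)) / 2 * ((1 + s / √(s ^ 2 + ε ^ 2)) / 2) +
      (s + √(s ^ 2 + ε ^ 2)) / 2 * (ε ^ 2 / √(s ^ 2 + ε ^ 2) ^ 3 / 2),
    hd, fun s => (hd s).mul (hd2 s), ?_, ?_, ?_, ?_, ?_, ?_, ?_, ?_, ?_, ?_⟩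
  · have := fun s => (hq s).ne'
    fun_prop (disch := assumption)
  · have := fun s => (hq s).ne'
    have h3 := fun s => pow_ne_zero 3 (hq s).ne'
    fun_prop (disch := assumption)
  · intro s
    have h1 : 0 ≤ (s + √(s ^ 2 + ε ^ 2)) / 2 := by linarith [neg_abs_le s, hqs s]
    have h2 : 0 ≤ ε ^ 2 / √(s ^ 2 + ε ^ 2) ^ 3 / 2 := by positivity
    have := mul_nonneg h1 h2
    linarith
  · intro s
    have h : |s| < √(s ^ 2 + ε ^ 2) := Real.lt_sqrt_of_sq_lt (by rw [sq_abs]; nlinarith)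
    linarith [neg_abs_le s]
  · intro s
    have : -1 ≤ s / √(s ^ 2 + ε ^ 2) := by
      rw [le_div_iff₀ (hq s)]; linarith [neg_abs_le s, hqs s]
    linarith
  · intro s
    have : s / √(s ^ 2 + ε ^ 2) ≤ 1 := by
      rw [div_le_one (hq s)]; linarith [le_abs_self s, hqs s]
    linarith
  · intro s
    have h : s * ((1 + s / √(s ^ 2 + ε ^ 2)) / 2) - (s + √(s ^ 2 + ε ^ 2)) / 2
        = -(ε ^ 2 / √(s ^ 2 + ε ^ 2) / 2) := by
      have := (hq s).ne'
      field_simp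
      linarith [hq2 s]
    have h2 : ε ^ 2 / √(s ^ 2 + ε ^ 2) ≤ ε := by
      rw [div_le_iff₀ (hq s)]; nlinarith [hqε s]
    have h3 : 0 ≤ ε ^ 2 / √(s ^ 2 + ε ^ 2) := by positivity
    rw [h, abs_neg, abs_of_nonneg (by positivity)]
    linarith
  · intro s
    linarith [le_abs_self s, hqs s]
  · intro s
    linarith [le_abs_self s, hqle s]
  · intro s hs
    have := hqle s
    rw [abs_of_nonpos hs] at this
    linarith

section AlmostMinimizer

variable {E : Type*} [NormedAddCommGroup E] [InnerProductSpace ℝ E] [FiniteDimensional ℝ E]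
  [MeasurableSpace E] [BorelSpace E]

theorem Continuous.integrable_of_eq_zero_off {g : E → ℝ} (hg : Continuous g) {K : Set E}
    (hK : IsCompact K) (h : ∀ x ∉ K, g x = 0) : Integrable g :=
  hg.integrable_of_hasCompactSupport (HasCompactSupport.intro hK h)

/-- If `v` solves `-Δv = c v` weakly and cutoffs have small energy against `v²`, then smooth
approximations of the positive part of `v` almost minimize the quadratic form
`∫ ‖∇φ‖² - c φ²`. -/
theorem exists_cutoff_posPart_energy_le {c v : E → ℝ} (hc : Continuous c) (hv : ContDiff ℝ 1 v)
    (hlin : ∀ ψ : E → ℝ, ContDiff ℝ 1 ψ → HasCompactSupport ψ →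
      ∫ x, (inner ℝ (gradient v x) (gradient ψ x) - c x * v x * ψ x) = 0)
    (hcut : ∀ τ > 0, ∀ R : ℝ, ∃ η : E → ℝ, ContDiff ℝ 1 η ∧ HasCompactSupport η ∧
      (∀ x ∈ ball (0 : E) R, η x = 1) ∧ ∫ x, v x ^ 2 * ‖gradient η x‖ ^ 2 ≤ τ)
    {τ : ℝ} (hτ : 0 < τ) (R : ℝ) :
    ∃ η : E → ℝ, ContDiff ℝ 1 η ∧ HasCompactSupport η ∧ (∀ x ∈ ball (0 : E) R, η x = 1) ∧
      ∃ ε₀ > 0, ∀ ε, 0 < ε → ε ≤ ε₀ → ∀ G G' H', IsSmoothPosPart ε G G' H' →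
        ∫ x, (‖G (v x) • gradient η x + (η x * G' (v x)) • gradient v x‖ ^ 2 -
          c x * (G (v x) * η x) ^ 2) ≤ τ := by
  obtain ⟨η, hη, hηc, hη1, hηi⟩ := hcut (τ / 4) (by positivity) R
  have hgη := hη.continuous_gradient
  have hgv := hv.continuous_gradient
  have hηK : IsCompact (tsupport η) := hηc.isCompact
  have hη0 : ∀ x ∉ tsupport η, η x = 0 := fun x hx => image_eq_zero_of_notMem_tsupport hx
  have hgη0 : ∀ x ∉ tsupport η, gradient η x = 0 :=
    fun x hx => gradient_eq_zero_of_notMem_tsupport hx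
  set D := ∫ x, (2 * ‖gradient η x‖ ^ 2 + |c x| * (|v x| + 1) * η x ^ 2) with hD
  have hD0 : 0 ≤ D := integral_nonneg fun x => by positivity
  have hDi : Integrable fun x => 2 * ‖gradient η x‖ ^ 2 + |c x| * (|v x| + 1) * η x ^ 2 := by
    refine Continuous.integrable_of_eq_zero_off ?_ hηK fun x hx => by simp [hη0 x hx, hgη0 x hx]
    have := hη.continuous
    have := hv.continuous
    fun_prop
  have hVi : Integrable fun x => v x ^ 2 * ‖gradient η x‖ ^ 2 := by
    refine Continuous.integrable_of_eq_zero_off ?_ hηK fun x hx => by simp [hgη0 x hx]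
    have := hv.continuous
    fun_prop
  refine ⟨η, hη, hηc, hη1, min 1 (τ / (2 * (D + 1))), by positivity, ?_⟩
  intro ε hε hεle G G' H' hG
  have hε1 : ε ≤ 1 := hεle.trans (min_le_left _ _)
  have hεD : ε * D ≤ τ / 2 := by
    have h1 : ε ≤ τ / (2 * (D + 1)) := hεle.trans (min_le_right _ _)
    rw [le_div_iff₀ (by positivity)] at h1
    nlinarith
  have hGc : Continuous G := continuous_iff_continuousAt.2 fun s => (hG.hasDerivAt s).continuousAt
  have hG'c := hG.continuous_deriv
  have hH'c := hG.continuous_deriv_mul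
  have hvc := hv.continuous
  have hηcc := hη.continuous
  -- the test function `G(v) G'(v) η²`
  have hGG1 : ContDiff ℝ 1 fun s => G s * G' s := by
    rw [contDiff_one_iff_deriv]
    refine ⟨fun s => (hG.hasDerivAt_mul s).differentiableAt, ?_⟩
    rw [show deriv (fun s => G s * G' s) = H' from funext fun s => (hG.hasDerivAt_mul s).deriv]
    exact hH'c
  set ψ : E → ℝ := fun x => G (v x) * G' (v x) * (η x * η x) with hψ
  have hψ1 : ContDiff ℝ 1 ψ := (hGG1.comp hv).mul (hη.mul hη)
  have hψc : HasCompactSupport ψ := HasCompactSupport.intro hηK fun x hx => by simp [hψ, hη0 x hx]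
  have hgψ : ∀ x, gradient ψ x = (G (v x) * G' (v x)) • (η x • gradient η x + η x • gradient η x)
      + (η x * η x) • (H' (v x) • gradient v x) := fun x =>
    (((hG.hasDerivAt_mul (v x)).comp_hasGradientAt (hv.hasGradientAt_real x)).mul_real
      ((hη.hasGradientAt_real x).mul_real (hη.hasGradientAt_real x))).gradient
  have hψi : Integrable fun x =>
      inner ℝ (gradient v x) (gradient ψ x) - c x * v x * ψ x := by
    refine Continuous.integrable_of_eq_zero_off ?_ hηK fun x hx => by
      rw [hgψ]
      simp [hψ, hη0 x hx]
    have := hψ1.continuous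
    have := hψ1.continuous_gradient
    fun_prop
  have hQi : Integrable fun x =>
      ‖G (v x) • gradient η x + (η x * G' (v x)) • gradient v x‖ ^ 2 -
          c x * (G (v x) * η x) ^ 2 := by
    refine Continuous.integrable_of_eq_zero_off ?_ hηK fun x hx => by simp [hη0 x hx, hgη0 x hx]
    fun_prop
  have key : ∀ x, ‖G (v x) • gradient η x + (η x * G' (v x)) • gradient v x‖ ^ 2 -
        c x * (G (v x) * η x) ^ 2 - (inner ℝ (gradient v x) (gradient ψ x) - c x * v x * ψ x)
      ≤ 2 * (v x ^ 2 * ‖gradient η x‖ ^ 2) +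
        ε * (2 * ‖gradient η x‖ ^ 2 + |c x| * (|v x| + 1) * η x ^ 2) := by
    intro x
    rw [hgψ, norm_add_sq_real]
    simp only [inner_add_right, inner_smul_left, inner_smul_right, norm_smul, mul_pow,
      real_inner_self_eq_norm_sq, real_inner_comm (gradient v x) (gradient η x), hψ,
      Real.norm_eq_abs, sq_abs, RCLike.conj_to_real]
    have h1 := mul_nonneg (mul_nonneg (sub_nonneg.2 (hG.sq_le (v x))) (sq_nonneg (η x)))
      (sq_nonneg ‖gradient v x‖)
    have hg0 := (hG.pos (v x)).le
    have hgle := hG.le_abs_add (v x)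
    have h2 : G (v x) ^ 2 * ‖gradient η x‖ ^ 2 ≤
        (2 * v x ^ 2 + 2 * ε) * ‖gradient η x‖ ^ 2 := by
      refine mul_le_mul_of_nonneg_right ?_ (sq_nonneg _)
      have : G (v x) ^ 2 ≤ (|v x| + ε) ^ 2 := pow_le_pow_left₀ hg0 hgle 2
      nlinarith [sq_abs (v x), sq_nonneg (|v x| - ε)]
    have h3 : c x * (G (v x) * (v x * G' (v x) - G (v x))) * η x ^ 2 ≤
        |c x| * ((|v x| + 1) * ε) * η x ^ 2 := by
      refine mul_le_mul_of_nonneg_right ?_ (sq_nonneg _)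
      refine (le_abs_self _).trans ?_
      rw [abs_mul, abs_mul, abs_of_nonneg hg0]
      have := hG.abs_sub_le (v x)
      gcongr
      linarith
    linarith
  have hle := integral_mono (hQi.sub hψi) ((hVi.const_mul 2).add (hDi.const_mul ε)) key
  simp only [Pi.sub_apply, Pi.add_apply] at hle
  rw [integral_sub hQi hψi, hlin ψ hψ1 hψc, integral_add (hVi.const_mul 2) (hDi.const_mul ε),
    integral_const_mul, integral_const_mul, ← hD] at hle
  linarith

end AlmostMinimizer

section LogEstimate

variable {E : Type*} [NormedAddCommGroup E] [InnerProductSpace ℝ E]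

/-- The logarithmic gradient estimate, at a point: `p`, `z` are the gradients of `v` and of the
cutoff `ζ`, while `W` and `g` are the values of the approximate positive part of `v` and of its
derivative. -/
theorem log_gradient_pointwise_le {W g δ ζ c : ℝ} (p z : E) (hW : 0 < W) (hδ : 0 < δ) :
    inner ℝ (g • p) ((ζ * ζ) • ((-(W + δ)⁻¹ ^ 2 * g) • p) + (W + δ)⁻¹ • ((2 * ζ) • z)) -
        c * W * (ζ * ζ * (W + δ)⁻¹) ≤
      (2 * ‖z‖ ^ 2 + |c| * ζ ^ 2) - ζ ^ 2 * ‖(g * (W + δ)⁻¹) • p‖ ^ 2 / 2 := by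
  set m := (W + δ)⁻¹ with hm
  have hm0 : 0 < m := by positivity
  have hWm : W * m ≤ 1 := by
    rw [hm, ← div_eq_mul_inv, div_le_one (by positivity)]; linarith
  have h1 : -(c * (W * m) * ζ ^ 2) ≤ |c| * ζ ^ 2 := by
    rw [← neg_mul]
    refine mul_le_mul_of_nonneg_right ?_ (sq_nonneg _)
    have h3 : |c * (W * m)| ≤ |c| := by
      rw [abs_mul, abs_of_nonneg (by positivity : 0 ≤ W * m)]
      exact mul_le_of_le_one_right (abs_nonneg _) hWm
    linarith [neg_abs_le (c * (W * m))]
  have h2 : 0 ≤ ‖(ζ * (g * m)) • p - (2 : ℝ) • z‖ ^ 2 := sq_nonneg _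
  rw [norm_sub_sq_real] at h2
  simp only [inner_add_right, inner_smul_left, inner_smul_right, norm_smul, mul_pow,
      real_inner_self_eq_norm_sq, Real.norm_eq_abs, sq_abs, RCLike.conj_to_real] at h2 ⊢
  linarith

theorem energy_test_pointwise_le {W g δ ζ c : ℝ} (p z : E) (hW : 0 < W) (hδ : 0 < δ)
    (hg0 : 0 ≤ g) (hg1 : g ≤ 1) :
    ‖(ζ * ζ) • ((-(W + δ)⁻¹ ^ 2 * g) • p) + (W + δ)⁻¹ • ((2 * ζ) • z)‖ ^ 2 -
        c * (ζ * ζ * (W + δ)⁻¹) ^ 2 ≤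
      (ζ * ζ * (δ⁻¹ ^ 2 * ‖p‖) + δ⁻¹ * (2 * |ζ| * ‖z‖)) ^ 2 + |c| * (ζ * ζ * δ⁻¹) ^ 2 := by
  have hm0 : 0 < (W + δ)⁻¹ := by positivity
  have hm : (W + δ)⁻¹ ≤ δ⁻¹ := inv_anti₀ hδ (by linarith)
  have hζ : 0 ≤ ζ * ζ := mul_self_nonneg ζ
  have h1 : ‖(ζ * ζ) • ((-(W + δ)⁻¹ ^ 2 * g) • p) + (W + δ)⁻¹ • ((2 * ζ) • z)‖ ≤
      ζ * ζ * (δ⁻¹ ^ 2 * ‖p‖) + δ⁻¹ * (2 * |ζ| * ‖z‖) := by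
    refine (norm_add_le _ _).trans ?_
    simp only [norm_smul, norm_mul, norm_neg, norm_pow, Real.norm_eq_abs, abs_mul_abs_self,
      abs_of_pos hm0, abs_of_nonneg hg0, abs_two]
    gcongr
    calc (W + δ)⁻¹ ^ 2 * g ≤ δ⁻¹ ^ 2 * 1 := by gcongr
      _ = δ⁻¹ ^ 2 := mul_one _
  have h2 : -(c * (ζ * ζ * (W + δ)⁻¹) ^ 2) ≤ |c| * (ζ * ζ * δ⁻¹) ^ 2 := by
    rw [← neg_mul]
    calc -c * (ζ * ζ * (W + δ)⁻¹) ^ 2 ≤ |c| * (ζ * ζ * (W + δ)⁻¹) ^ 2 :=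
          mul_le_mul_of_nonneg_right (neg_le_abs c) (sq_nonneg _)
      _ ≤ _ := by gcongr
  have := pow_le_pow_left₀ (norm_nonneg _) h1 2
  linarith

variable [FiniteDimensional ℝ E] [MeasurableSpace E] [BorelSpace E]

/-- A uniform local bound for the gradient of `log (G(v) + δ)`, where `G(v)` approximates the
positive part of a solution `v` of the linearized equation. -/
theorem exists_log_gradient_bound {c v : E → ℝ} (hc : Continuous c) (hv : ContDiff ℝ 1 v)
    (hstab : ∀ φ : E → ℝ, ContDiff ℝ 1 φ → HasCompactSupport φ →
      0 ≤ ∫ x, (‖gradient φ x‖ ^ 2 - c x * φ x ^ 2))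
    (hlin : ∀ ψ : E → ℝ, ContDiff ℝ 1 ψ → HasCompactSupport ψ →
      ∫ x, (inner ℝ (gradient v x) (gradient ψ x) - c x * v x * ψ x) = 0)
    (hcut : ∀ τ > 0, ∀ R : ℝ, ∃ η : E → ℝ, ContDiff ℝ 1 η ∧ HasCompactSupport η ∧
      (∀ x ∈ ball (0 : E) R, η x = 1) ∧ ∫ x, v x ^ 2 * ‖gradient η x‖ ^ 2 ≤ τ)
    {ζ : E → ℝ} (hζ : ContDiff ℝ 1 ζ) (hζc : HasCompactSupport ζ) :
    ∃ K : ℝ, ∀ δ > 0, ∃ ε, 0 < ε ∧ ε ≤ δ ∧ ∃ G G' H', IsSmoothPosPart ε G G' H' ∧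
      ∫ x, ζ x ^ 2 * ‖(G' (v x) * (G (v x) + δ)⁻¹) • gradient v x‖ ^ 2 ≤ K := by
  have hζK : IsCompact (tsupport ζ) := hζc.isCompact
  have hζ0 : ∀ x ∉ tsupport ζ, ζ x = 0 := fun x hx => image_eq_zero_of_notMem_tsupport hx
  have hgζ0 : ∀ x ∉ tsupport ζ, gradient ζ x = 0 :=
    fun x hx => gradient_eq_zero_of_notMem_tsupport hx
  obtain ⟨R, hR⟩ := hζK.isBounded.subset_ball (0 : E)
  have hgζ := hζ.continuous_gradient
  have hgv := hv.continuous_gradient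
  have hvc := hv.continuous
  have hζcc := hζ.continuous
  set A := ∫ x, (2 * ‖gradient ζ x‖ ^ 2 + |c x| * ζ x ^ 2) with hA
  have hAi : Integrable fun x => 2 * ‖gradient ζ x‖ ^ 2 + |c x| * ζ x ^ 2 := by
    refine Continuous.integrable_of_eq_zero_off ?_ hζK fun x hx => by simp [hζ0 x hx, hgζ0 x hx]
    fun_prop
  refine ⟨2 * (A + 1), fun δ hδ => ?_⟩
  set D := ∫ x, ((ζ x * ζ x * (δ⁻¹ ^ 2 * ‖gradient v x‖) +
    δ⁻¹ * (2 * |ζ x| * ‖gradient ζ x‖)) ^ 2 + |c x| * (ζ x * ζ x * δ⁻¹) ^ 2) with hD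
  have hDi : Integrable fun x => (ζ x * ζ x * (δ⁻¹ ^ 2 * ‖gradient v x‖) +
      δ⁻¹ * (2 * |ζ x| * ‖gradient ζ x‖)) ^ 2 + |c x| * (ζ x * ζ x * δ⁻¹) ^ 2 := by
    refine Continuous.integrable_of_eq_zero_off ?_ hζK fun x hx => by simp [hζ0 x hx]
    fun_prop
  have hD0 : 0 ≤ D := integral_nonneg fun x => by positivity
  set s := (D + 1)⁻¹ with hs
  have hs0 : 0 < s := by positivity
  have hsD : s * D ≤ 1 := by
    rw [hs, inv_mul_eq_div, div_le_one (by positivity)]; linarith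
  obtain ⟨η, hη, hηc, hη1, ε₀, hε₀, hQ⟩ := exists_cutoff_posPart_energy_le hc hv hlin hcut hs0 R
  obtain ⟨G, G', H', hG⟩ := exists_isSmoothPosPart (lt_min hε₀ hδ)
  refine ⟨min ε₀ δ, lt_min hε₀ hδ, min_le_right _ _, G, G', H', hG, ?_⟩
  have hQ := hQ _ (lt_min hε₀ hδ) (min_le_left _ _) G G' H' hG
  have hgη := hη.continuous_gradient
  have hηcc := hη.continuous
  have hηK : IsCompact (tsupport η) := hηc.isCompact
  have hη0 : ∀ x ∉ tsupport η, η x = 0 := fun x hx => image_eq_zero_of_notMem_tsupport hx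
  have hgη0 : ∀ x ∉ tsupport η, gradient η x = 0 :=
    fun x hx => gradient_eq_zero_of_notMem_tsupport hx
  have hG1 : ContDiff ℝ 1 G := by
    rw [contDiff_one_iff_deriv]
    refine ⟨fun s => (hG.hasDerivAt s).differentiableAt, ?_⟩
    rw [show deriv G = G' from funext fun s => (hG.hasDerivAt s).deriv]
    exact hG.continuous_deriv
  have hGc := hG1.continuous
  have hG'c := hG.continuous_deriv
  have hGδ : ∀ t, G t + δ ≠ 0 := fun t => (add_pos (hG.pos t) hδ).ne'
  have hinv : ∀ t, HasDerivAt (fun t => (G t + δ)⁻¹) (-(G t + δ)⁻¹ ^ 2 * G' t) t := fun t =>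
    (((hG.hasDerivAt t).add_const δ).inv (hGδ t)).congr_deriv (by field_simp)
  have hinv1 : ContDiff ℝ 1 fun t => (G t + δ)⁻¹ := (hG1.add contDiff_const).inv hGδ
  have hgw : ∀ x, HasGradientAt (fun x => G (v x) * η x)
      (G (v x) • gradient η x + (η x * G' (v x)) • gradient v x) x := fun x => by
    rw [mul_smul]
    exact ((hG.hasDerivAt (v x)).comp_hasGradientAt (hv.hasGradientAt_real x)).mul_real
      (hη.hasGradientAt_real x)
  have hgψ : ∀ x, HasGradientAt (fun x => ζ x * ζ x * (G (v x) + δ)⁻¹)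
      ((ζ x * ζ x) • ((-(G (v x) + δ)⁻¹ ^ 2 * G' (v x)) • gradient v x) +
        (G (v x) + δ)⁻¹ • ((2 * ζ x) • gradient ζ x)) x := fun x => by
    rw [two_mul, add_smul]
    exact ((hζ.hasGradientAt_real x).mul_real (hζ.hasGradientAt_real x)).mul_real
      ((hinv (v x)).comp_hasGradientAt (hv.hasGradientAt_real x))
  set φ : E → ℝ := fun x => G (v x) * η x + s * (ζ x * ζ x * (G (v x) + δ)⁻¹) with hφ
  have hφ1 : ContDiff ℝ 1 φ := ((hG1.comp hv).mul hη).add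
    (contDiff_const.mul ((hζ.mul hζ).mul (hinv1.comp hv)))
  have hφc : HasCompactSupport φ := HasCompactSupport.intro (hηK.union hζK) fun x hx => by
    simp only [Set.mem_union, not_or] at hx
    simp [hφ, hη0 x hx.1, hζ0 x hx.2]
  have hgφ : ∀ x, gradient φ x = (G (v x) • gradient η x + (η x * G' (v x)) • gradient v x) +
      s • ((ζ x * ζ x) • ((-(G (v x) + δ)⁻¹ ^ 2 * G' (v x)) • gradient v x) +
        (G (v x) + δ)⁻¹ • ((2 * ζ x) • gradient ζ x)) := fun x => by
    have h := (hgw x).add_real ((hasGradientAt_const x s).mul_real (hgψ x))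
    rw [smul_zero, add_zero] at h
    exact h.gradient
  have hφi : Integrable fun x => ‖gradient φ x‖ ^ 2 - c x * φ x ^ 2 := by
    refine Continuous.integrable_of_eq_zero_off ?_ (hηK.union hζK) fun x hx => ?_
    · have := hφ1.continuous
      have := hφ1.continuous_gradient
      fun_prop
    · simp only [Set.mem_union, not_or] at hx
      rw [hgφ]
      simp [hφ, hη0 x hx.1, hζ0 x hx.2, hgη0 x hx.1]
  have hQi : Integrable fun x =>
      ‖G (v x) • gradient η x + (η x * G' (v x)) • gradient v x‖ ^ 2 -
          c x * (G (v x) * η x) ^ 2 := by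
    refine Continuous.integrable_of_eq_zero_off ?_ hηK fun x hx => by simp [hη0 x hx, hgη0 x hx]
    fun_prop
  have hIi : Integrable fun x =>
      ζ x ^ 2 * ‖(G' (v x) * (G (v x) + δ)⁻¹) • gradient v x‖ ^ 2 := by
    refine Continuous.integrable_of_eq_zero_off ?_ hζK fun x hx => by simp [hζ0 x hx]
    have := hinv1.continuous.comp hvc
    simp only [Function.comp_def] at this
    fun_prop
  have key : ∀ x, ‖gradient φ x‖ ^ 2 - c x * φ x ^ 2 ≤
      (‖G (v x) • gradient η x + (η x * G' (v x)) • gradient v x‖ ^ 2 -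
          c x * (G (v x) * η x) ^ 2) +
      (2 * s * (2 * ‖gradient ζ x‖ ^ 2 + |c x| * ζ x ^ 2) -
        s * (ζ x ^ 2 * ‖(G' (v x) * (G (v x) + δ)⁻¹) • gradient v x‖ ^ 2) +
      s ^ 2 * ((ζ x * ζ x * (δ⁻¹ ^ 2 * ‖gradient v x‖) +
      δ⁻¹ * (2 * |ζ x| * ‖gradient ζ x‖)) ^ 2 + |c x| * (ζ x * ζ x * δ⁻¹) ^ 2)) := by
    intro x
    by_cases hx : x ∈ tsupport ζ
    · have hxR := hR hx
      have e1 : η x = 1 := hη1 x hxR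
      have e2 : gradient η x = 0 := gradient_eq_zero_of_eqOn isOpen_ball hη1 hxR
      have h1 := mul_le_mul_of_nonneg_left (log_gradient_pointwise_le (g := G' (v x)) (ζ := ζ x)
        (c := c x) (gradient v x) (gradient ζ x) (hG.pos (v x)) hδ) (by positivity : 0 ≤ 2 * s)
      have h2 := mul_le_mul_of_nonneg_left (energy_test_pointwise_le (ζ := ζ x) (c := c x)
        (gradient v x) (gradient ζ x) (hG.pos (v x)) hδ (hG.deriv_nonneg (v x))
        (hG.deriv_le_one (v x))) (by positivity : 0 ≤ s ^ 2)
      rw [hgφ, e1, e2, smul_zero, zero_add, one_mul, norm_add_sq_real, norm_smul s, mul_pow,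
        inner_smul_right, Real.norm_eq_abs, sq_abs]
      simp only [hφ, e1, mul_one]
      linarith
    · rw [hgφ]
      simp [hφ, hζ0 x hx, hgζ0 x hx]
  have hle := integral_mono hφi (hQi.add (((hAi.const_mul (2 * s)).sub (hIi.const_mul s)).add
    (hDi.const_mul (s ^ 2)))) key
  have h0 := hstab φ hφ1 hφc
  rw [integral_add' hQi (((hAi.const_mul (2 * s)).sub (hIi.const_mul s)).add
    (hDi.const_mul (s ^ 2))), integral_add' ((hAi.const_mul (2 * s)).sub (hIi.const_mul s))
    (hDi.const_mul (s ^ 2)), integral_sub' (hAi.const_mul (2 * s)) (hIi.const_mul s),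
    integral_const_mul, integral_const_mul, integral_const_mul, ← hD, ← hA] at hle
  set I := ∫ x, ζ x ^ 2 * ‖(G' (v x) * (G (v x) + δ)⁻¹) • gradient v x‖ ^ 2
  have h3 : s ^ 2 * D ≤ s := by nlinarith
  have h4 : s * I ≤ s * (2 * (A + 1)) := by linarith
  exact le_of_mul_le_mul_left h4 hs0

end LogEstimate

section NoSignChange

variable {E : Type*} [NormedAddCommGroup E] [InnerProductSpace ℝ E] [FiniteDimensional ℝ E]

theorem exists_cutoff_gradient_le (E : Type*) [NormedAddCommGroup E] [InnerProductSpace ℝ E]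
    [FiniteDimensional ℝ E] :
    ∃ C : ℝ, 0 ≤ C ∧ ∀ R > 0, ∃ η : E → ℝ, ContDiff ℝ 1 η ∧ tsupport η ⊆ closedBall 0 (2 * R) ∧
      (∀ x ∈ ball (0 : E) R, η x = 1) ∧ (∀ x, 0 ≤ η x) ∧ (∀ x, η x ≤ 1) ∧
      ∀ x, ‖gradient η x‖ ≤ C / R := by
  let ρ : ContDiffBump (0 : E) := ⟨1, 2, one_pos, one_lt_two⟩
  have hρ : ContDiff ℝ 1 ρ := ρ.contDiff
  obtain ⟨C, hC⟩ := (ρ.hasCompactSupport.fderiv ℝ).exists_bound_of_continuous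
    (hρ.continuous_fderiv one_ne_zero)
  have hC0 : 0 ≤ C := (norm_nonneg _).trans (hC 0)
  refine ⟨C, hC0, fun R hR => ⟨fun x => ρ (R⁻¹ • x), hρ.comp (contDiff_const_smul _), ?_, ?_,
    fun x => ρ.nonneg, fun x => ρ.le_one, ?_⟩⟩
  · refine closure_minimal (fun x hx => ?_) isClosed_closedBall
    have h : R⁻¹ • x ∈ Function.support ρ := hx
    rw [ρ.support_eq, mem_ball_zero_iff, norm_smul, norm_inv, Real.norm_of_nonneg hR.le,
      inv_mul_lt_iff₀ hR] at h
    have h2 : ‖x‖ < R * 2 := h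
    rw [mem_closedBall_zero_iff]
    linarith
  · intro x hx
    refine ρ.one_of_mem_closedBall ?_
    rw [mem_closedBall_zero_iff, norm_smul, norm_inv, Real.norm_of_nonneg hR.le,
      inv_mul_le_iff₀ hR]
    have h2 : ‖x‖ < R := mem_ball_zero_iff.1 hx
    change ‖x‖ ≤ R * 1
    linarith
  · intro x
    have h1 : HasFDerivAt (fun x : E => R⁻¹ • x) (R⁻¹ • ContinuousLinearMap.id ℝ E) x :=
      (hasFDerivAt_id x).const_smul R⁻¹
    have h2 := ((hρ.differentiable one_ne_zero) (R⁻¹ • x)).hasFDerivAt.comp x h1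
    rw [norm_gradient, show fderiv ℝ (fun x => ρ (R⁻¹ • x)) x = _ from h2.fderiv,
      ContinuousLinearMap.comp_smul, ContinuousLinearMap.comp_id, norm_smul, norm_inv,
      Real.norm_of_nonneg hR.le, ← div_eq_inv_mul]
    gcongr
    exact hC _

theorem log_sub_le_integral_norm_gradient {L : E → ℝ} {P : E → E}
    (hL : ∀ x, HasGradientAt L (P x) x) (hP : Continuous P) (y z : E) :
    L y - L (y + z) ≤ ∫ t in (0 : ℝ)..1, ‖z‖ * (‖P (y + t • z)‖ ^ 2 + 1) := by
  have hd : ∀ t : ℝ, HasDerivAt (fun t : ℝ => -L (y + t • z)) (-inner ℝ (P (y + t • z)) z) t := by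
    intro t
    have h1 : HasDerivAt (fun t : ℝ => y + t • z) z t := by
      simpa using ((hasDerivAt_id t).smul_const z).const_add y
    have h2 := ((hL (y + t • z)).hasFDerivAt.comp_hasDerivAt t h1).neg
    rw [InnerProductSpace.toDual_apply_apply] at h2
    exact h2
  have hc : Continuous fun t : ℝ => -inner ℝ (P (y + t • z)) z := by fun_prop
  have h := intervalIntegral.integral_eq_sub_of_hasDerivAt (a := 0) (b := 1) (fun t _ => hd t)
    (hc.intervalIntegrable _ _)
  have h0 : L y - L (y + z) = ∫ t in (0 : ℝ)..1, -inner ℝ (P (y + t • z)) z := by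
    rw [h]; simp; ring
  rw [h0]
  refine intervalIntegral.integral_mono_on zero_le_one (hc.intervalIntegrable _ _)
    (Continuous.intervalIntegrable (by fun_prop) _ _) fun t _ => ?_
  have h1 := (neg_le_abs _).trans (abs_real_inner_le_norm (P (y + t • z)) z)
  have h2 : ‖P (y + t • z)‖ ≤ ‖P (y + t • z)‖ ^ 2 + 1 := by
    nlinarith [sq_nonneg (‖P (y + t • z)‖ - 1)]
  calc _ ≤ ‖P (y + t • z)‖ * ‖z‖ := h1
    _ ≤ (‖P (y + t • z)‖ ^ 2 + 1) * ‖z‖ := by gcongr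
    _ = _ := mul_comm _ _

variable [MeasurableSpace E] [BorelSpace E]

/-- If a differentiable function drops by at least `X` between two translates of a ball, then its
Dirichlet energy on the convex hull of their union is bounded below. -/
theorem mul_measureReal_le_of_sub_ge {L : E → ℝ} {P : E → E}
    (hL : ∀ x, HasGradientAt L (P x) x) (hP : Continuous P) {ζ : E → ℝ} (hζ : Continuous ζ)
    (hζc : HasCompactSupport ζ) {a z : E} {r X K : ℝ}
    (hζ1 : ∀ y ∈ closedBall a r, ∀ t ∈ Set.Icc (0 : ℝ) 1, ζ (y + t • z) = 1)
    (hX : ∀ y ∈ closedBall a r, X ≤ L y - L (y + z))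
    (hK : ∫ x, ζ x ^ 2 * ‖P x‖ ^ 2 ≤ K) :
    X * volume.real (closedBall a r) ≤ ‖z‖ * (K + volume.real (closedBall a r)) := by
  set B := closedBall a r with hB
  have hBc : IsCompact B := isCompact_closedBall a r
  have hBm : volume B ≠ ⊤ := hBc.measure_lt_top.ne
  set Φ : E → ℝ → ℝ := fun y t => ‖z‖ * (‖P (y + t • z)‖ ^ 2 + 1) with hΦ
  have hΦc : Continuous (Function.uncurry Φ) := by
    simp only [hΦ, Function.uncurry_def]; fun_prop
  have hprod : Integrable (Function.uncurry Φ)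
      ((volume.restrict B).prod (volume.restrict (Set.Ioc (0 : ℝ) 1))) := by
    rw [Measure.prod_restrict]
    exact (hΦc.continuousOn.integrableOn_compact (hBc.prod (isCompact_Icc (a := (0 : ℝ)) (b := 1)))
      ).mono_set (Set.prod_mono le_rfl Set.Ioc_subset_Icc_self)
  have hIi : Integrable fun x => ζ x ^ 2 * ‖P x‖ ^ 2 := by
    refine (by fun_prop : Continuous fun x => ζ x ^ 2 * ‖P x‖ ^ 2).integrable_of_eq_zero_off
      hζc.isCompact fun x hx => by simp [image_eq_zero_of_notMem_tsupport hx]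
  have hinner : ∀ t ∈ Set.Icc (0 : ℝ) 1, ∫ y in B, Φ y t ≤ ‖z‖ * (K + volume.real B) := by
    intro t ht
    have hi : IntegrableOn (fun y => ‖P (y + t • z)‖ ^ 2) B :=
      (by fun_prop : Continuous fun y => ‖P (y + t • z)‖ ^ 2).continuousOn.integrableOn_compact hBc
    simp only [hΦ]
    rw [integral_const_mul, integral_add hi (integrableOn_const hBm), setIntegral_const,
      smul_eq_mul, mul_one]
    gcongr
    calc ∫ y in B, ‖P (y + t • z)‖ ^ 2
        = ∫ y in B, ζ (y + t • z) ^ 2 * ‖P (y + t • z)‖ ^ 2 :=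
          setIntegral_congr_fun isClosed_closedBall.measurableSet fun y hy => by
            simp [hζ1 y hy t ht]
      _ ≤ ∫ y, ζ (y + t • z) ^ 2 * ‖P (y + t • z)‖ ^ 2 :=
          setIntegral_le_integral (hIi.comp_add_right (t • z))
            (Eventually.of_forall fun y => by positivity)
      _ = ∫ y, ζ y ^ 2 * ‖P y‖ ^ 2 :=
          integral_add_right_eq_self (fun y => ζ y ^ 2 * ‖P y‖ ^ 2) (t • z)
      _ ≤ K := hK
  calc X * volume.real B = ∫ _ in B, X := by rw [setIntegral_const, smul_eq_mul, mul_comm]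
    _ ≤ ∫ y in B, ∫ t in Set.Ioc (0 : ℝ) 1, Φ y t := by
        refine setIntegral_mono_on (integrableOn_const hBm) hprod.integral_prod_left
          isClosed_closedBall.measurableSet fun y hy => ?_
        refine (hX y hy).trans ((log_sub_le_integral_norm_gradient hL hP y z).trans_eq ?_)
        rw [intervalIntegral.integral_of_le zero_le_one]
    _ = ∫ t in Set.Ioc (0 : ℝ) 1, ∫ y in B, Φ y t := integral_integral_swap hprod
    _ ≤ ∫ _ in Set.Ioc (0 : ℝ) 1, ‖z‖ * (K + volume.real B) :=
        setIntegral_mono_on hprod.integral_prod_right (integrableOn_const (by simp))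
          measurableSet_Ioc fun t ht => hinner t (Set.Ioc_subset_Icc_self ht)
    _ = ‖z‖ * (K + volume.real B) := by simp

/-- A solution of the linearized equation against which cutoffs have small energy does not change
sign, if the equation is stable. -/
theorem nonneg_of_pos_of_stable {c v : E → ℝ} (hc : Continuous c) (hv : ContDiff ℝ 1 v)
    (hstab : ∀ φ : E → ℝ, ContDiff ℝ 1 φ → HasCompactSupport φ →
      0 ≤ ∫ x, (‖gradient φ x‖ ^ 2 - c x * φ x ^ 2))
    (hlin : ∀ ψ : E → ℝ, ContDiff ℝ 1 ψ → HasCompactSupport ψ →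
      ∫ x, (inner ℝ (gradient v x) (gradient ψ x) - c x * v x * ψ x) = 0)
    (hcut : ∀ τ > 0, ∀ R : ℝ, ∃ η : E → ℝ, ContDiff ℝ 1 η ∧ HasCompactSupport η ∧
      (∀ x ∈ ball (0 : E) R, η x = 1) ∧ ∫ x, v x ^ 2 * ‖gradient η x‖ ^ 2 ≤ τ)
    {a b : E} (ha : 0 < v a) : 0 ≤ v b := by
  by_contra! hb
  obtain ⟨r₁, hr₁, h₁⟩ := Metric.nhds_basis_closedBall.mem_iff.1
    (hv.continuous.continuousAt.eventually (lt_mem_nhds (half_lt_self ha)))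
  obtain ⟨r₂, hr₂, h₂⟩ := Metric.nhds_basis_closedBall.mem_iff.1
    (hv.continuous.continuousAt.eventually (gt_mem_nhds hb))
  set z := b - a with hz
  set r := min r₁ r₂ with hr
  have hr0 : 0 < r := lt_min hr₁ hr₂
  set B := closedBall a r with hB
  obtain ⟨C, -, hcutoff⟩ := exists_cutoff_gradient_le E
  obtain ⟨ζ, hζ, hζs, hζ1, -⟩ := hcutoff (‖a‖ + r + ‖z‖ + 1) (by positivity)
  have hζc : HasCompactSupport ζ :=
    HasCompactSupport.of_support_subset_isCompact (isCompact_closedBall _ _)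
      ((subset_tsupport _).trans hζs)
  obtain ⟨K, hK⟩ := exists_log_gradient_bound hc hv hstab hlin hcut hζ hζc
  set m := volume.real B with hm
  have hm0 : 0 < m := ENNReal.toReal_pos (measure_closedBall_pos volume a hr0).ne'
    (isCompact_closedBall a r).measure_lt_top.ne
  set X := (‖z‖ * (K + m) + 1) / m with hX
  obtain ⟨ε, hε, hεδ, G, G', H', hG, hI⟩ :=
    hK (v a / 2 / 2 * Real.exp (-X)) (by positivity)
  set δ := v a / 2 / 2 * Real.exp (-X) with hδ
  have hδ0 : 0 < δ := by positivity
  have hGδ : ∀ t, 0 < G t + δ := fun t => add_pos (hG.pos t) hδ0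
  have hL : ∀ x, HasGradientAt (fun x => Real.log (G (v x) + δ))
      ((G' (v x) * (G (v x) + δ)⁻¹) • gradient v x) x := fun x =>
    HasDerivAt.comp_hasGradientAt (g := fun t => Real.log (G t + δ))
      (((hG.hasDerivAt (v x)).add_const δ).log (hGδ _).ne') (hv.hasGradientAt_real x)
  have hGc : Continuous G := continuous_iff_continuousAt.2 fun s => (hG.hasDerivAt s).continuousAt
  have hP : Continuous fun x => (G' (v x) * (G (v x) + δ)⁻¹) • gradient v x := by
    have h1 := hG.continuous_deriv
    have h2 := hv.continuous
    have h3 := hv.continuous_gradient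
    have h4 : ∀ x, G (v x) + δ ≠ 0 := fun x => (hGδ _).ne'
    fun_prop (disch := assumption)
  have hle := mul_measureReal_le_of_sub_ge hL hP hζ.continuous hζc (a := a) (z := z) (r := r)
    (X := X) ?_ ?_ hI
  · rw [← hB, ← hm, hX, div_mul_cancel₀ _ hm0.ne'] at hle
    linarith
  · intro y hy t ht
    refine hζ1 _ ?_
    rw [mem_ball_zero_iff]
    have h1 : ‖y - a‖ ≤ r := by rw [← dist_eq_norm]; exact hy
    have h2 : ‖t • z‖ ≤ ‖z‖ := by
      rw [norm_smul, Real.norm_of_nonneg ht.1]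
      exact mul_le_of_le_one_left (norm_nonneg _) ht.2
    calc ‖y + t • z‖ = ‖a + (y - a) + t • z‖ := by congr 1; abel
      _ ≤ ‖a‖ + ‖y - a‖ + ‖t • z‖ := norm_add₃_le
      _ < ‖a‖ + r + ‖z‖ + 1 := by linarith
  · intro y hy
    have hy1 : v a / 2 < v y :=
      h₁ (closedBall_subset_closedBall (hr.trans_le (min_le_left r₁ r₂)) hy)
    have hy2 : v (y + z) < 0 := by
      refine h₂ (closedBall_subset_closedBall (hr.trans_le (min_le_right r₁ r₂)) ?_)
      have : y + z - b = y - a := by rw [hz]; abel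
      rw [mem_closedBall, dist_eq_norm, this, ← dist_eq_norm]
      exact hy
    have e1 : Real.log (v a / 2) ≤ Real.log (G (v y) + δ) :=
      Real.log_le_log (by positivity) (by linarith [hG.self_le (v y)])
    have e2 : Real.log (G (v (y + z)) + δ) ≤ Real.log (v a / 2 * Real.exp (-X)) :=
      Real.log_le_log (hGδ _) (by linarith [hG.le_of_nonpos _ hy2.le])
    rw [Real.log_mul (by positivity) (Real.exp_ne_zero _), Real.log_exp] at e2
    linarith

end NoSignChange

section EuclideanIntegrals

variable {N : ℕ}

theorem inner_gradient_gradient_eq_sum (φ ψ : EuclideanSpace ℝ (Fin N) → ℝ)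
    (x : EuclideanSpace ℝ (Fin N)) :
    inner ℝ (gradient φ x) (gradient ψ x) =
      ∑ i, fderiv ℝ φ x (EuclideanSpace.single i 1) *
        fderiv ℝ ψ x (EuclideanSpace.single i 1) := by
  rw [← (EuclideanSpace.basisFun (Fin N) ℝ).sum_inner_mul_inner]
  refine Finset.sum_congr rfl fun i _ => ?_
  rw [real_inner_comm (gradient ψ x), inner_gradient_eq_fderiv, inner_gradient_eq_fderiv,
    EuclideanSpace.basisFun_apply]

theorem ContDiff.fderiv_apply_const {n m : WithTop ℕ∞} {φ : EuclideanSpace ℝ (Fin N) → ℝ}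
    (hφ : ContDiff ℝ n φ) (h : m + 1 ≤ n) (e : EuclideanSpace ℝ (Fin N)) :
    ContDiff ℝ m fun x => fderiv ℝ φ x e :=
  (hφ.fderiv_right h).clm_apply contDiff_const

theorem fderiv_fderiv_apply_comm {φ : EuclideanSpace ℝ (Fin N) → ℝ} (hφ : ContDiff ℝ 2 φ)
    (x a b : EuclideanSpace ℝ (Fin N)) :
    fderiv ℝ (fun y => fderiv ℝ φ y a) x b = fderiv ℝ (fun y => fderiv ℝ φ y b) x a := by
  have hd : DifferentiableAt ℝ (fderiv ℝ φ) x :=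
    ((hφ.fderiv_right (m := 1) (by norm_num)).differentiable one_ne_zero) x
  have h : ∀ c d, fderiv ℝ (fun y => fderiv ℝ φ y c) x d = fderiv ℝ (fderiv ℝ φ) x d c := by
    intro c d
    rw [fderiv_clm_apply hd (differentiableAt_const c)]
    simp
  rw [h, h]
  exact (hφ.contDiffAt.isSymmSndFDerivAt (by simp)).eq b a

theorem integral_mul_fderiv_eq_neg_of_hasCompactSupport
    {g ψ : EuclideanSpace ℝ (Fin N) → ℝ} (hg : ContDiff ℝ 1 g) (hψ : ContDiff ℝ 1 ψ)
    (hψc : HasCompactSupport ψ) (e : EuclideanSpace ℝ (Fin N)) :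
    ∫ x, g x * fderiv ℝ ψ x e = -∫ x, fderiv ℝ g x e * ψ x := by
  have h1 := hg.continuous
  have h2 := hψ.continuous
  have h3 : Continuous fun x => fderiv ℝ g x e :=
    (hg.fderiv_apply_const (m := 0) (by norm_num) e).continuous
  have h4 : Continuous fun x => fderiv ℝ ψ x e :=
    (hψ.fderiv_apply_const (m := 0) (by norm_num) e).continuous
  exact integral_mul_fderiv_eq_neg_fderiv_mul_of_integrable
    ((h3.mul h2).integrable_of_hasCompactSupport hψc.mul_left)
    ((h1.mul h4).integrable_of_hasCompactSupport (hψc.fderiv_apply ℝ e).mul_left)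
    ((h1.mul h2).integrable_of_hasCompactSupport hψc.mul_left)
    (fun x _ => hg.differentiable one_ne_zero x) (fun x _ => hψ.differentiable one_ne_zero x)

theorem integral_inner_gradient_eq_sum {g ψ : EuclideanSpace ℝ (Fin N) → ℝ}
    (hg : ContDiff ℝ 1 g) (hψ : ContDiff ℝ 1 ψ) (hψc : HasCompactSupport ψ) :
    ∫ x, inner ℝ (gradient g x) (gradient ψ x) =
      ∑ i, ∫ x, fderiv ℝ g x (EuclideanSpace.single i 1) *
        fderiv ℝ ψ x (EuclideanSpace.single i 1) := by
  simp_rw [inner_gradient_gradient_eq_sum]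
  refine integral_finsetSum _ fun i _ => ?_
  have h3 : Continuous fun x => fderiv ℝ g x (EuclideanSpace.single i 1) :=
    (hg.fderiv_apply_const (m := 0) (by norm_num) _).continuous
  have h4 : Continuous fun x => fderiv ℝ ψ x (EuclideanSpace.single i 1) :=
    (hψ.fderiv_apply_const (m := 0) (by norm_num) _).continuous
  exact (h3.mul h4).integrable_of_hasCompactSupport (hψc.fderiv_apply ℝ _).mul_left

/-- Green's identity: the weak form of a semilinear equation. -/
theorem integral_inner_gradient_of_coordLaplacian {f : ℝ → ℝ}
    {u : EuclideanSpace ℝ (Fin N) → ℝ} (hu : ContDiff ℝ 2 u)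
    (heq : ∀ x, coordLaplacian u x + f (u x) = 0) {ψ : EuclideanSpace ℝ (Fin N) → ℝ}
    (hψ : ContDiff ℝ 1 ψ) (hψc : HasCompactSupport ψ) :
    ∫ x, inner ℝ (gradient u x) (gradient ψ x) = ∫ x, f (u x) * ψ x := by
  have hu1 : ContDiff ℝ 1 u := hu.of_le (by norm_num)
  have hui : ∀ i : Fin N, ContDiff ℝ 1 fun y => fderiv ℝ u y (EuclideanSpace.single i 1) :=
    fun i => hu.fderiv_apply_const (by norm_num) _
  rw [integral_inner_gradient_eq_sum hu1 hψ hψc]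
  simp_rw [fun i => integral_mul_fderiv_eq_neg_of_hasCompactSupport (hui i) hψ hψc
    (EuclideanSpace.single i 1)]
  rw [Finset.sum_neg_distrib, ← integral_finsetSum, ← integral_neg]
  · refine integral_congr_ae (Eventually.of_forall fun x => ?_)
    have h := heq x
    simp only [coordLaplacian] at h
    simp only [← Finset.sum_mul]
    linear_combination (-ψ x) * h
  · intro i _
    have h3 : Continuous fun x => fderiv ℝ (fun y => fderiv ℝ u y (EuclideanSpace.single i 1)) x
        (EuclideanSpace.single i 1) :=
      ((hui i).fderiv_apply_const (m := 0) (by norm_num) _).continuous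
    exact (h3.mul hψ.continuous).integrable_of_hasCompactSupport hψc.mul_left

/-- Directional derivatives of a solution solve the linearized equation weakly. -/
theorem integral_linearized_eq_zero {f : ℝ → ℝ} (hf : ContDiff ℝ 1 f)
    {u : EuclideanSpace ℝ (Fin N) → ℝ} (hu : ContDiff ℝ 2 u)
    (heq : ∀ x, coordLaplacian u x + f (u x) = 0) (e : EuclideanSpace ℝ (Fin N))
    {ψ : EuclideanSpace ℝ (Fin N) → ℝ} (hψ : ContDiff ℝ 1 ψ) (hψc : HasCompactSupport ψ) :
    ∫ x, (inner ℝ (gradient (fun y => fderiv ℝ u y e) x) (gradient ψ x) -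
      deriv f (u x) * fderiv ℝ u x e * ψ x) = 0 := by
  have hu1 : ContDiff ℝ 1 u := hu.of_le (by norm_num)
  have hv : ContDiff ℝ 1 fun y => fderiv ℝ u y e := hu.fderiv_apply_const (by norm_num) _
  have hc : Continuous fun x => deriv f (u x) :=
    (hf.continuous_deriv le_rfl).comp hu.continuous
  have hsmooth : ∀ ψ : EuclideanSpace ℝ (Fin N) → ℝ, ContDiff ℝ (⊤ : ℕ∞) ψ →
      HasCompactSupport ψ →
      ∫ x, (inner ℝ (gradient (fun y => fderiv ℝ u y e) x) (gradient ψ x) -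
        deriv f (u x) * fderiv ℝ u x e * ψ x) = 0 := by
    intro ψ hψ hψc
    have hψ1 : ContDiff ℝ 1 ψ := hψ.of_le (by exact_mod_cast le_top)
    have hψ2 : ContDiff ℝ 2 ψ := contDiff_infty.1 hψ 2
    have hψe : ContDiff ℝ 1 fun y => fderiv ℝ ψ y e := hψ2.fderiv_apply_const (by norm_num) _
    have hψec : HasCompactSupport fun y => fderiv ℝ ψ y e := hψc.fderiv_apply ℝ e
    have key := integral_inner_gradient_of_coordLaplacian hu heq hψe hψec
    have h1 : ∫ x, f (u x) * fderiv ℝ ψ x e =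
        -∫ x, deriv f (u x) * fderiv ℝ u x e * ψ x := by
      refine (integral_mul_fderiv_eq_neg_of_hasCompactSupport (hf.comp hu1) hψ1 hψc e).trans ?_
      congr 2
      ext x
      rw [((hf.differentiable one_ne_zero (u x)).hasDerivAt.comp_hasFDerivAt x
        (hu1.differentiable one_ne_zero x).hasFDerivAt).fderiv]
      simp
    have h2 : ∫ x, inner ℝ (gradient (fun y => fderiv ℝ u y e) x) (gradient ψ x) =
        -∫ x, inner ℝ (gradient u x) (gradient (fun y => fderiv ℝ ψ y e) x) := by
      rw [integral_inner_gradient_eq_sum hv hψ1 hψc, integral_inner_gradient_eq_sum hu1 hψe hψec,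
        ← Finset.sum_neg_distrib]
      refine Finset.sum_congr rfl fun i _ => ?_
      simp_rw [fun x => fderiv_fderiv_apply_comm hu x e, fun x => fderiv_fderiv_apply_comm hψ2 x e]
      rw [integral_mul_fderiv_eq_neg_of_hasCompactSupport
        (hu.fderiv_apply_const (by norm_num) _) (hψ2.fderiv_apply_const (by norm_num) _)
        (hψc.fderiv_apply ℝ _), neg_neg]
    rw [integral_sub, h2, key, h1, neg_neg, sub_self]
    · exact (hv.continuous_gradient.inner hψ1.continuous_gradient).integrable_of_eq_zero_off
        hψc.isCompact fun x hx => by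
          rw [gradient_eq_zero_of_notMem_tsupport hx, inner_zero_right]
    · exact ((hc.mul hv.continuous).mul hψ.continuous).integrable_of_hasCompactSupport
        hψc.mul_left
  obtain ⟨ψ', h1, h2, h3⟩ := exists_seq_contDiff_tendsto_integral hψ hψc
  have h4 := h3 (fun p => inner ℝ (gradient (fun y => fderiv ℝ u y e) p.1) p.2.2 -
      deriv f (u p.1) * fderiv ℝ u p.1 e * p.2.1)
    (((hv.continuous_gradient.comp continuous_fst).inner continuous_snd.snd).sub
      (((hc.comp continuous_fst).mul (hv.continuous.comp continuous_fst)).mul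
        continuous_snd.fst)) (by simp)
  refine tendsto_nhds_unique h4 ?_
  simp only [fun n => hsmooth (ψ' n) (h1 n) (h2 n), tendsto_const_nhds_iff]

theorem stable_of_smooth {c : EuclideanSpace ℝ (Fin N) → ℝ} (hc : Continuous c)
    (hstab : ∀ φ : EuclideanSpace ℝ (Fin N) → ℝ, ContDiff ℝ (⊤ : ℕ∞) φ → HasCompactSupport φ →
      0 ≤ ∫ x, (‖gradient φ x‖ ^ 2 - c x * (φ x) ^ 2))
    {φ : EuclideanSpace ℝ (Fin N) → ℝ} (hφ : ContDiff ℝ 1 φ) (hφc : HasCompactSupport φ) :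
    0 ≤ ∫ x, (‖gradient φ x‖ ^ 2 - c x * (φ x) ^ 2) := by
  obtain ⟨ψ, h1, h2, h3⟩ := exists_seq_contDiff_tendsto_integral hφ hφc
  have h4 := h3 (fun p => ‖p.2.2‖ ^ 2 - c p.1 * p.2.1 ^ 2) (by fun_prop) (by simp)
  exact ge_of_tendsto' h4 fun n => hstab (ψ n) (h1 n) (h2 n)

end EuclideanIntegrals

section Energy

theorem exists_truncation {k : ℝ} (hk : 0 < k) :
    ∃ G : ℝ → ℝ, ContDiff ℝ 1 G ∧ (∀ s, |s| ≤ k → G s = 0) ∧ (∀ s, 0 ≤ deriv G s) ∧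
      (∀ s, ∃ θ, 0 ≤ θ ∧ θ ≤ 1 ∧ G s = s * θ) ∧ ∀ s, |s - G s| ≤ 2 * k := by
  have hS : ContDiff ℝ 1 Real.smoothTransition := Real.smoothTransition.contDiff
  refine ⟨fun s => s * Real.smoothTransition ((s / k) ^ 2 - 1), by fun_prop, ?_, ?_, ?_, ?_⟩
  · intro s hs
    have h : (s / k) ^ 2 ≤ 1 := by
      rw [div_pow, div_le_one (by positivity)]
      exact sq_le_sq' (abs_le.1 hs).1 (abs_le.1 hs).2
    simp [Real.smoothTransition.zero_of_nonpos (x := (s / k) ^ 2 - 1) (by linarith)]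
  · intro s
    have h1 : HasDerivAt (fun s : ℝ => (s / k) ^ 2 - 1) (2 * (s / k) * (1 / k)) s := by
      simpa using (((hasDerivAt_id s).div_const k).pow 2).sub_const 1
    have h2 := (hS.differentiable one_ne_zero ((s / k) ^ 2 - 1)).hasDerivAt.comp s h1
    have h3 := ((hasDerivAt_id s).mul h2).deriv
    have h4 : 0 ≤ deriv Real.smoothTransition ((s / k) ^ 2 - 1) :=
      Real.smoothTransition.monotone.deriv_nonneg
    have h5 := Real.smoothTransition.nonneg ((s / k) ^ 2 - 1)
    have h6 : deriv (fun s => s * Real.smoothTransition ((s / k) ^ 2 - 1)) s =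
        Real.smoothTransition ((s / k) ^ 2 - 1) +
          deriv Real.smoothTransition ((s / k) ^ 2 - 1) * (2 * (s / k) ^ 2) := by
      refine h3.trans ?_
      simp only [Function.comp_apply, id_eq]
      field_simp
    rw [h6]
    positivity
  · exact fun s => ⟨_, Real.smoothTransition.nonneg _, Real.smoothTransition.le_one _, rfl⟩
  · intro s
    have h0 := Real.smoothTransition.nonneg ((s / k) ^ 2 - 1)
    have h1 := Real.smoothTransition.le_one ((s / k) ^ 2 - 1)
    rcases le_or_gt |s| (2 * k) with hs | hs
    · calc |s - s * Real.smoothTransition ((s / k) ^ 2 - 1)|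
          = |s| * |1 - Real.smoothTransition ((s / k) ^ 2 - 1)| := by rw [← abs_mul]; ring_nf
        _ ≤ |s| * 1 := by
            gcongr
            rw [abs_le]
            constructor <;> linarith
        _ ≤ 2 * k := by linarith
    · have h : 2 ≤ (s / k) ^ 2 := by
        rw [div_pow, le_div_iff₀ (by positivity), ← sq_abs s]
        nlinarith
      simp [Real.smoothTransition.one_of_one_le (x := (s / k) ^ 2 - 1) (by linarith), hk.le]

variable {E : Type*} [NormedAddCommGroup E] [InnerProductSpace ℝ E] [FiniteDimensional ℝ E]
  [MeasurableSpace E] [BorelSpace E]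

/-- Dimension-free energy bound: a decaying weak solution of `-Δu = w` with `w u ≤ 0` off a
compact set has finite Dirichlet energy. -/
theorem integral_cutoff_mul_norm_gradient_sq_le {u w : E → ℝ} (hu : ContDiff ℝ 1 u)
    (hw : Continuous w) (hloc : Tendsto u (cocompact E) (𝓝 0))
    (hweak : ∀ ψ : E → ℝ, ContDiff ℝ 1 ψ → HasCompactSupport ψ →
      ∫ x, inner ℝ (gradient u x) (gradient ψ x) = ∫ x, w x * ψ x)
    {K : Set E} (hK : IsCompact K) (hKw : ∀ x ∉ K, w x * u x ≤ 0)
    {ζ : E → ℝ} (hζ : ContDiff ℝ 1 ζ) (hζc : HasCompactSupport ζ) (hζ0 : ∀ x, 0 ≤ ζ x)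
    (hζ1 : ∀ x, ζ x ≤ 1) :
    ∫ x, ζ x * ‖gradient u x‖ ^ 2 ≤ ∫ x in K, |w x * u x| := by
  have hgu := hu.continuous_gradient
  have hgζ := hζ.continuous_gradient
  have hI1 : Integrable fun x => ζ x * ‖gradient u x‖ ^ 2 :=
    (hζ.continuous.mul (hgu.norm.pow 2)).integrable_of_hasCompactSupport hζc.mul_right
  have hI2 : Integrable fun x => ‖gradient u x‖ * ‖gradient ζ x‖ :=
    (hgu.norm.mul hgζ.norm).integrable_of_eq_zero_off hζc.isCompact fun x hx => by
      simp [gradient_eq_zero_of_notMem_tsupport hx]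
  set A := ∫ x, ‖gradient u x‖ * ‖gradient ζ x‖ with hA
  have hA0 : 0 ≤ A := integral_nonneg fun x => by positivity
  have main : ∀ k > 0, ∫ x, ζ x * ‖gradient u x‖ ^ 2 ≤ (∫ x in K, |w x * u x|) + 2 * k * A := by
    intro k hk
    obtain ⟨G, hG, hGk, hG', hGθ, hGs⟩ := exists_truncation hk
    obtain ⟨L, hL, hLu⟩ := mem_cocompact.1
      (hloc.eventually (ball_mem_nhds (0 : ℝ) hk))
    let ψ : E → ℝ := fun x => ζ x * (u x - G (u x)) + G (u x)
    have hψ : ContDiff ℝ 1 ψ := (hζ.mul (hu.sub (hG.comp hu))).add (hG.comp hu)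
    have hψc : HasCompactSupport ψ := by
      refine HasCompactSupport.intro (hζc.isCompact.union hL) fun x hx => ?_
      rw [Set.mem_union, not_or] at hx
      have h1 : ζ x = 0 := image_eq_zero_of_notMem_tsupport hx.1
      have h2 : |u x| ≤ k := by
        have : u x ∈ ball (0 : ℝ) k := hLu hx.2
        rw [mem_ball_zero_iff, Real.norm_eq_abs] at this
        exact this.le
      simp [ψ, h1, hGk _ h2]
    have hgrad : ∀ x, gradient ψ x = (ζ x • ((1 - deriv G (u x)) • gradient u x) +
        (u x - G (u x)) • gradient ζ x) + deriv G (u x) • gradient u x := by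
      intro x
      have hg := (hG.differentiable one_ne_zero (u x)).hasDerivAt
      have h1 := hu.hasGradientAt_real x
      exact (((hζ.hasGradientAt_real x).mul_real
        (((hasDerivAt_id (u x)).sub hg).comp_hasGradientAt h1)).add_real
          (hg.comp_hasGradientAt h1)).gradient
    have hlow : ∀ x, ζ x * ‖gradient u x‖ ^ 2 - 2 * k * (‖gradient u x‖ * ‖gradient ζ x‖) ≤
        inner ℝ (gradient u x) (gradient ψ x) := by
      intro x
      rw [hgrad x]
      simp only [inner_add_right, inner_smul_right, real_inner_self_eq_norm_sq]
      have h1 : |(u x - G (u x)) * inner ℝ (gradient u x) (gradient ζ x)| ≤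
          2 * k * (‖gradient u x‖ * ‖gradient ζ x‖) := by
        rw [abs_mul]
        gcongr
        · exact hGs _
        · exact abs_real_inner_le_norm _ _
      have h2 : 0 ≤ (1 - ζ x) * deriv G (u x) * ‖gradient u x‖ ^ 2 :=
        mul_nonneg (mul_nonneg (sub_nonneg.2 (hζ1 x)) (hG' _)) (by positivity)
      linarith [(abs_le.1 h1).1]
    have hup : ∀ x, w x * ψ x ≤ K.indicator (fun x => |w x * u x|) x := by
      intro x
      obtain ⟨θ, hθ0, hθ1, hθ⟩ := hGθ (u x)
      have h1 : w x * ψ x = w x * u x * (ζ x + (1 - ζ x) * θ) := by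
        simp only [ψ, hθ]; ring
      have h2 : 0 ≤ ζ x + (1 - ζ x) * θ :=
        add_nonneg (hζ0 x) (mul_nonneg (sub_nonneg.2 (hζ1 x)) hθ0)
      have h3 : ζ x + (1 - ζ x) * θ ≤ 1 := by nlinarith [hζ1 x]
      rw [h1]
      by_cases hx : x ∈ K
      · rw [Set.indicator_of_mem hx]
        calc w x * u x * (ζ x + (1 - ζ x) * θ) ≤ |w x * u x| * (ζ x + (1 - ζ x) * θ) :=
              mul_le_mul_of_nonneg_right (le_abs_self _) h2
          _ ≤ |w x * u x| := mul_le_of_le_one_right (abs_nonneg _) h3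
      · rw [Set.indicator_of_notMem hx]
        exact mul_nonpos_of_nonpos_of_nonneg (hKw x hx) h2
    have hI3 : Integrable fun x => inner ℝ (gradient u x) (gradient ψ x) :=
      (hgu.inner hψ.continuous_gradient).integrable_of_eq_zero_off hψc.isCompact
        fun x hx => by rw [gradient_eq_zero_of_notMem_tsupport hx, inner_zero_right]
    have hI4 : Integrable fun x => w x * ψ x :=
      (hw.mul hψ.continuous).integrable_of_hasCompactSupport hψc.mul_left
    have hI5 : Integrable (K.indicator fun x => |w x * u x|) :=
      (integrable_indicator_iff hK.measurableSet).2
        ((hw.mul hu.continuous).abs.continuousOn.integrableOn_compact hK)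
    have e1 := integral_mono (hI1.sub (hI2.const_mul (2 * k))) hI3 hlow
    have e2 := integral_mono hI4 hI5 hup
    rw [integral_indicator hK.measurableSet] at e2
    have e3 : ∫ x, (ζ x * ‖gradient u x‖ ^ 2 - 2 * k * (‖gradient u x‖ * ‖gradient ζ x‖)) =
        (∫ x, ζ x * ‖gradient u x‖ ^ 2) - 2 * k * A := by
      rw [integral_sub hI1 (hI2.const_mul _), integral_const_mul]
    have e4 := hweak ψ hψ hψc
    simp only [Pi.sub_apply] at e1
    linarith
  refine le_of_forall_pos_le_add fun ε hε => (main (ε / (2 * (A + 1))) (by positivity)).trans ?_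
  have : 2 * (ε / (2 * (A + 1))) * A ≤ ε := by
    have h : 2 * (ε / (2 * (A + 1))) * A = ε * (A / (A + 1)) := by field_simp
    rw [h]
    exact mul_le_of_le_one_right hε.le ((div_le_one (by positivity)).2 (by linarith))
  linarith

/-- Functions dominated by a gradient of finite energy admit cutoffs of small cost. -/
theorem exists_cutoff_small_cost {u v : E → ℝ} (hu : ContDiff ℝ 1 u) (hv : Continuous v)
    (hvu : ∀ x, |v x| ≤ ‖gradient u x‖) {M : ℝ}
    (hM : ∀ ζ : E → ℝ, ContDiff ℝ 1 ζ → HasCompactSupport ζ → (∀ x, 0 ≤ ζ x) →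
      (∀ x, ζ x ≤ 1) → ∫ x, ζ x * ‖gradient u x‖ ^ 2 ≤ M) {τ : ℝ} (hτ : 0 < τ) (R : ℝ) :
    ∃ η : E → ℝ, ContDiff ℝ 1 η ∧ HasCompactSupport η ∧ (∀ x ∈ ball (0 : E) R, η x = 1) ∧
      ∫ x, v x ^ 2 * ‖gradient η x‖ ^ 2 ≤ τ := by
  obtain ⟨C, hC, hcutoff⟩ := exists_cutoff_gradient_le E
  have hlim : Tendsto (fun r : ℝ => (C / r) ^ 2 * M) atTop (𝓝 0) := by
    have h : Tendsto (fun r : ℝ => C / r) atTop (𝓝 0) := tendsto_const_nhds.div_atTop tendsto_id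
    simpa using (h.pow 2).mul_const M
  obtain ⟨r, hr, hrR, hr0⟩ := ((hlim.eventually (gt_mem_nhds hτ)).and
    ((eventually_ge_atTop R).and (eventually_gt_atTop 0))).exists
  have hcpt : ∀ {η : E → ℝ} {ρ : ℝ}, tsupport η ⊆ closedBall 0 ρ → HasCompactSupport η :=
    fun h => HasCompactSupport.of_support_subset_isCompact (isCompact_closedBall _ _)
      ((subset_tsupport _).trans h)
  obtain ⟨η, hη, hηs, hη1, -, -, hηC⟩ := hcutoff r hr0
  obtain ⟨ζ, hζ, hζs, hζ1, hζ0, hζle, -⟩ := hcutoff (2 * r + 1) (by positivity)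
  have hηc := hcpt hηs
  have hζc := hcpt hζs
  refine ⟨η, hη, hηc, fun x hx => hη1 x (ball_subset_ball hrR hx), ?_⟩
  have hle : ∀ x, v x ^ 2 * ‖gradient η x‖ ^ 2 ≤ (C / r) ^ 2 * (ζ x * ‖gradient u x‖ ^ 2) := by
    intro x
    by_cases hx : x ∈ tsupport η
    · have hz : ζ x = 1 := hζ1 x (closedBall_subset_ball (by linarith) (hηs hx))
      have h1 : v x ^ 2 ≤ ‖gradient u x‖ ^ 2 := sq_le_sq.2 ((hvu x).trans (le_abs_self _))
      rw [hz, one_mul, mul_comm]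
      gcongr
      exact hηC x
    · rw [gradient_eq_zero_of_notMem_tsupport hx]
      have : 0 ≤ (C / r) ^ 2 * (ζ x * ‖gradient u x‖ ^ 2) :=
        mul_nonneg (sq_nonneg _) (mul_nonneg (hζ0 x) (sq_nonneg _))
      simpa using this
  calc ∫ x, v x ^ 2 * ‖gradient η x‖ ^ 2
      ≤ ∫ x, (C / r) ^ 2 * (ζ x * ‖gradient u x‖ ^ 2) := by
        refine integral_mono ?_ ?_ hle
        · exact ((hv.pow 2).mul (hη.continuous_gradient.norm.pow 2)).integrable_of_eq_zero_off
            hηc.isCompact fun x hx => by simp [gradient_eq_zero_of_notMem_tsupport hx]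
        · exact ((hζ.continuous.mul
            (hu.continuous_gradient.norm.pow 2)).integrable_of_hasCompactSupport
            hζc.mul_right).const_mul _
    _ = (C / r) ^ 2 * ∫ x, ζ x * ‖gradient u x‖ ^ 2 := integral_const_mul _ _
    _ ≤ (C / r) ^ 2 * M := by
        gcongr
        exact hM ζ hζ hζc hζ0 hζle
    _ ≤ τ := hr.le

end Energy

section Conclusion

theorem exists_deriv_pos_and_neg_of_pos {g g' : ℝ → ℝ} (hg : ∀ t, HasDerivAt g (g' t) t)
    (htop : Tendsto g atTop (𝓝 0)) (hbot : Tendsto g atBot (𝓝 0)) (h0 : 0 < g 0) :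
    (∃ a, 0 < g' a) ∧ ∃ b, g' b < 0 := by
  have hc : Continuous g := continuous_iff_continuousAt.2 fun t => (hg t).continuousAt
  constructor
  · obtain ⟨t, ht, ht0⟩ := ((hbot.eventually (gt_mem_nhds h0)).and (eventually_lt_atBot 0)).exists
    obtain ⟨a, -, ha⟩ := exists_hasDerivAt_eq_slope g g' ht0 hc.continuousOn fun t _ => hg t
    exact ⟨a, ha ▸ div_pos (by linarith) (by linarith)⟩
  · obtain ⟨t, ht, ht0⟩ := ((htop.eventually (gt_mem_nhds h0)).and (eventually_gt_atTop 0)).exists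
    obtain ⟨a, -, ha⟩ := exists_hasDerivAt_eq_slope g g' ht0 hc.continuousOn fun t _ => hg t
    exact ⟨a, ha ▸ div_neg_of_neg_of_pos (by linarith) (by linarith)⟩

theorem exists_deriv_pos_and_neg {g g' : ℝ → ℝ} (hg : ∀ t, HasDerivAt g (g' t) t)
    (htop : Tendsto g atTop (𝓝 0)) (hbot : Tendsto g atBot (𝓝 0)) (h0 : g 0 ≠ 0) :
    (∃ a, 0 < g' a) ∧ ∃ b, g' b < 0 := by
  rcases h0.lt_or_gt with h | h
  · obtain ⟨⟨a, ha⟩, b, hb⟩ := exists_deriv_pos_and_neg_of_pos (g := -g) (g' := -g')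
      (fun t => (hg t).neg) (neg_zero (G := ℝ) ▸ htop.neg) (neg_zero (G := ℝ) ▸ hbot.neg)
      (by simpa using h)
    exact ⟨⟨b, by simpa using hb⟩, a, by simpa using ha⟩
  · exact exists_deriv_pos_and_neg_of_pos hg htop hbot h

theorem mul_nonpos_of_deriv_nonpos {f : ℝ → ℝ} (hf : Differentiable ℝ f) (hf0 : f 0 = 0) {δ : ℝ}
    (hδ : 0 ≤ δ) (hf' : ∀ s : ℝ, |s| ≤ δ → deriv f s ≤ 0) {s : ℝ} (hs : |s| ≤ δ) :
    f s * s ≤ 0 := by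
  have hanti : AntitoneOn f (Set.Icc (-δ) δ) :=
    antitoneOn_of_deriv_nonpos (convex_Icc _ _) hf.continuous.continuousOn
      hf.differentiableOn fun x hx => hf' x (abs_le.2 (Set.mem_Icc.1 (interior_subset hx)))
  have hs' : s ∈ Set.Icc (-δ) δ := abs_le.1 hs
  have h0 : (0 : ℝ) ∈ Set.Icc (-δ) δ := by constructor <;> linarith
  rcases le_total 0 s with h | h
  · exact mul_nonpos_of_nonpos_of_nonneg (hf0 ▸ hanti h0 hs' h) h
  · exact mul_nonpos_of_nonneg_of_nonpos (hf0 ▸ hanti hs' h0 h) h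

theorem tendsto_add_smul_cocompact {E : Type*} [NormedAddCommGroup E] [NormedSpace ℝ E]
    [ProperSpace E] (x : E) {e : E} (he : ‖e‖ = 1) {l : Filter ℝ}
    (hl : Tendsto (fun t : ℝ => |t|) l atTop) :
    Tendsto (fun t : ℝ => x + t • e) l (cocompact E) := by
  refine tendsto_cocompact_of_tendsto_dist_comp_atTop x ?_
  simpa [dist_eq_norm, norm_smul, he] using hl

end Conclusion

theorem stmt_0 {N : ℕ} (hN : 1 ≤ N) (f : ℝ → ℝ) (hf : ContDiff ℝ 1 f) (hf0 : f 0 = 0)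
    (δ : ℝ) (hδ : 0 < δ) (hf' : ∀ s : ℝ, |s| ≤ δ → deriv f s ≤ 0)
    (u : EuclideanSpace ℝ (Fin N) → ℝ) (hu : ContDiff ℝ 2 u)
    (heq : ∀ x, coordLaplacian u x + f (u x) = 0)
    (hloc : Tendsto u (cocompact (EuclideanSpace ℝ (Fin N))) (nhds 0))
    (hstab : ∀ φ : EuclideanSpace ℝ (Fin N) → ℝ, ContDiff ℝ (⊤ : ℕ∞) φ → HasCompactSupport φ →
      0 ≤ ∫ x, (‖gradient φ x‖ ^ 2 - deriv f (u x) * (φ x) ^ 2)) :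
    ∀ x, u x = 0 := by
  intro x
  by_contra hx
  let e : EuclideanSpace ℝ (Fin N) := EuclideanSpace.single ⟨0, hN⟩ 1
  have he : ‖e‖ = 1 := by simp [e]
  have hu1 : ContDiff ℝ 1 u := hu.of_le (by norm_num)
  have hv : ContDiff ℝ 1 fun y => fderiv ℝ u y e := hu.fderiv_apply_const (by norm_num) _
  have hc : Continuous fun y => deriv f (u y) :=
    (hf.continuous_deriv le_rfl).comp hu.continuous
  obtain ⟨K, hK, hKu⟩ := mem_cocompact.1 (hloc.eventually (ball_mem_nhds (0 : ℝ) hδ))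
  have hKw : ∀ y ∉ K, f (u y) * u y ≤ 0 := fun y hy => by
    have h : u y ∈ ball (0 : ℝ) δ := hKu hy
    rw [mem_ball_zero_iff, Real.norm_eq_abs] at h
    exact mul_nonpos_of_deriv_nonpos (hf.differentiable one_ne_zero) hf0 hδ.le hf' h.le
  have hen := fun ζ hζ hζc hζ0 hζ1 => integral_cutoff_mul_norm_gradient_sq_le hu1
    (hf.continuous.comp hu.continuous) hloc
    (fun ψ hψ hψc => integral_inner_gradient_of_coordLaplacian hu heq hψ hψc) hK hKw
    (ζ := ζ) hζ hζc hζ0 hζ1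
  have hvu : ∀ y, |fderiv ℝ u y e| ≤ ‖gradient u y‖ := fun y => by
    rw [norm_gradient, ← Real.norm_eq_abs]
    simpa [he] using (fderiv ℝ u y).le_opNorm e
  have hg : ∀ t : ℝ, HasDerivAt (fun t : ℝ => u (x + t • e)) (fderiv ℝ u (x + t • e) e) t := by
    intro t
    have h1 : HasDerivAt (fun t : ℝ => x + t • e) e t := by
      simpa using ((hasDerivAt_id t).smul_const e).const_add x
    exact (hu1.differentiable one_ne_zero _).hasFDerivAt.comp_hasDerivAt t h1
  obtain ⟨⟨a, ha⟩, b, hb⟩ := exists_deriv_pos_and_neg hg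
    (hloc.comp (tendsto_add_smul_cocompact x he tendsto_abs_atTop_atTop))
    (hloc.comp (tendsto_add_smul_cocompact x he tendsto_abs_atBot_atTop)) (by simpa using hx)
  exact hb.not_ge (nonneg_of_pos_of_stable hc hv
    (fun φ hφ hφc => stable_of_smooth hc hstab hφ hφc)
    (fun ψ hψ hψc => integral_linearized_eq_zero hf hu heq e hψ hψc)
    (fun τ hτ R => exists_cutoff_small_cost hu1 hv.continuous hvu hen hτ R) ha)
end

section
/- Let N ≥ 1 and let f : ℝ → ℝ be continuously differentiable with f(0) = 0, and suppose there exists δ > 0 such that f'(s) ≤ 0 for all s with |s| ≤ δ. Let u₁ and u₂ be two distinct classical solutions of Δu + f(u) = 0 in ℝ^N, both localized (tending to 0 as |x| → ∞), both not identically zero, and suppose at least one of them changes sign (takes both positive and negative values). Then the difference u₁ − u₂ changes sign, i.e., there exist points x, y ∈ ℝ^N with u₁(x) > u₂(x) and u₁(y) < u₂(y). -/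
open MeasureTheory Filter

section CoordLaplacian

variable {N : ℕ}

lemma differentiable_partial {u : EuclideanSpace ℝ (Fin N) → ℝ} (hu : ContDiff ℝ 2 u)
    (e : EuclideanSpace ℝ (Fin N)) : Differentiable ℝ (fun y => fderiv ℝ u y e) :=
  ((hu.fderiv_right (m := 1) (by norm_num)).clm_apply contDiff_const).differentiable one_ne_zero

lemma coordLaplacian_sub {u v : EuclideanSpace ℝ (Fin N) → ℝ} (hu : ContDiff ℝ 2 u)
    (hv : ContDiff ℝ 2 v) (x : EuclideanSpace ℝ (Fin N)) :
    coordLaplacian (fun y => u y - v y) x = coordLaplacian u x - coordLaplacian v x := by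
  have h1 : ∀ y, fderiv ℝ (fun y => u y - v y) y = fderiv ℝ u y - fderiv ℝ v y := fun y =>
    fderiv_fun_sub (hu.differentiable two_ne_zero y) (hv.differentiable two_ne_zero y)
  simp only [coordLaplacian, h1, ← Finset.sum_sub_distrib, sub_apply]
  refine Finset.sum_congr rfl fun i _ => ?_
  rw [fderiv_fun_sub (differentiable_partial hu _ x) (differentiable_partial hv _ x)]
  rfl

lemma coordLaplacian_sub_const (u : EuclideanSpace ℝ (Fin N) → ℝ) (c : ℝ)
    (x : EuclideanSpace ℝ (Fin N)) :
    coordLaplacian (fun y => u y - c) x = coordLaplacian u x := by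
  simp only [coordLaplacian, fderiv_sub_const]

lemma coordLaplacian_comp_add_right (u : EuclideanSpace ℝ (Fin N) → ℝ)
    (a x : EuclideanSpace ℝ (Fin N)) :
    coordLaplacian (fun y => u (y + a)) x = coordLaplacian u (x + a) := by
  simp only [coordLaplacian, fderiv_comp_add_right]
  refine Finset.sum_congr rfl fun i _ => ?_
  rw [fderiv_comp_add_right (f := fun y => fderiv ℝ u y (EuclideanSpace.single i 1)) a]

lemma deriv_deriv_nonneg_of_isLocalMin {g : ℝ → ℝ} {t : ℝ} (hg : ContinuousAt g t)
    (h : IsLocalMin g t) : 0 ≤ deriv (deriv g) t := by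
  by_contra! hneg
  have hmax := isLocalMax_of_deriv_deriv_neg hneg h.deriv_eq_zero hg
  have hconst : g =ᶠ[nhds t] fun _ => g t := by
    filter_upwards [h, hmax] with s h1 h2 using le_antisymm h2 h1
  have := hconst.deriv.deriv_eq
  simp at this
  linarith

lemma coordLaplacian_nonneg_of_isLocalMin {u : EuclideanSpace ℝ (Fin N) → ℝ}
    (hu : ContDiff ℝ 2 u) {p : EuclideanSpace ℝ (Fin N)} (h : IsLocalMin u p) :
    0 ≤ coordLaplacian u p := by
  refine Finset.sum_nonneg fun i _ => ?_
  set e : EuclideanSpace ℝ (Fin N) := EuclideanSpace.single i 1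
  have hline : ∀ t : ℝ, HasDerivAt (fun t : ℝ => p + t • e) e t := fun t => by
    simpa using ((hasDerivAt_id t).smul_const e).const_add p
  have hcomp : ∀ {w : EuclideanSpace ℝ (Fin N) → ℝ}, Differentiable ℝ w → ∀ t : ℝ,
      deriv (fun t : ℝ => w (p + t • e)) t = fderiv ℝ w (p + t • e) e := fun hw t =>
    ((hw (p + t • e)).hasFDerivAt.comp_hasDerivAt t (hline t)).deriv
  have hmin : IsLocalMin (fun t : ℝ => u (p + t • e)) 0 := by
    have hc : Tendsto (fun t : ℝ => p + t • e) (nhds 0) (nhds p) := by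
      simpa using (hline 0).continuousAt.tendsto
    have := hc.eventually h
    simpa [IsLocalMin, IsMinFilter] using this
  have hcont : ContinuousAt (fun t : ℝ => u (p + t • e)) 0 :=
    (hu.continuous.comp (by fun_prop)).continuousAt
  have := deriv_deriv_nonneg_of_isLocalMin hcont hmin
  rw [funext (hcomp (hu.differentiable two_ne_zero)), hcomp (differentiable_partial hu e)] at this
  simpa using this

/-- The Gaussian barrier `ε (exp (-α |x - c|²) - b)` used in the strong maximum principle. -/
noncomputable def gaussianBarrier (ε α b : ℝ) (c x : EuclideanSpace ℝ (Fin N)) : ℝ :=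
  ε * (Real.exp (-α * ‖x - c‖ ^ 2) - b)

lemma contDiff_gaussianBarrier (ε α b : ℝ) (c : EuclideanSpace ℝ (Fin N)) :
    ContDiff ℝ 2 (gaussianBarrier ε α b c) := by
  have h : ContDiff ℝ 2 fun x : EuclideanSpace ℝ (Fin N) => ‖x - c‖ ^ 2 :=
    (contDiff_id.sub contDiff_const).norm_sq ℝ
  exact contDiff_const.mul (((contDiff_const.mul h).exp).sub contDiff_const)

lemma coordLaplacian_gaussianBarrier (ε α b : ℝ) (c x : EuclideanSpace ℝ (Fin N)) :
    coordLaplacian (gaussianBarrier ε α b c) x =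
      ε * Real.exp (-α * ‖x - c‖ ^ 2) * (4 * α ^ 2 * ‖x - c‖ ^ 2 - 2 * α * N) := by
  have hexp : ∀ y : EuclideanSpace ℝ (Fin N), HasFDerivAt
      (fun y => Real.exp (-α * ‖y - c‖ ^ 2))
      (Real.exp (-α * ‖y - c‖ ^ 2) • (-α) • (2 • (innerSL ℝ (y - c)).comp
        (ContinuousLinearMap.id ℝ _))) y := fun y =>
    ((((hasFDerivAt_id y).sub_const c).norm_sq).const_mul (-α)).exp
  have h1 : ∀ y, fderiv ℝ (gaussianBarrier ε α b c) y = _ := fun y =>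
    (((hexp y).sub_const b).const_mul ε).fderiv
  have h2 : ∀ i : Fin N, (fun y => fderiv ℝ (gaussianBarrier ε α b c) y
      (EuclideanSpace.single i 1)) =
      fun y => (-2 * α * ε) * (Real.exp (-α * ‖y - c‖ ^ 2) * (y i - c i)) := fun i => by
    funext y
    rw [h1]
    simp [EuclideanSpace.inner_single_right]
    ring
  have hcoord : ∀ i : Fin N, HasFDerivAt (fun y : EuclideanSpace ℝ (Fin N) => y i - c i)
      (EuclideanSpace.proj i : EuclideanSpace ℝ (Fin N) →L[ℝ] ℝ) x := fun i =>
    ((EuclideanSpace.proj i : EuclideanSpace ℝ (Fin N) →L[ℝ] ℝ).hasFDerivAt).sub_const _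
  have h3 : ∀ i : Fin N, fderiv ℝ (fun y => fderiv ℝ (gaussianBarrier ε α b c) y
      (EuclideanSpace.single i 1)) x (EuclideanSpace.single i 1) =
      ε * Real.exp (-α * ‖x - c‖ ^ 2) * (4 * α ^ 2 * (x i - c i) ^ 2 - 2 * α) := fun i => by
    rw [h2, (((hexp x).fun_mul (hcoord i)).const_mul (-2 * α * ε)).fderiv]
    simp [EuclideanSpace.inner_single_right]
    ring
  simp only [coordLaplacian, h3]
  rw [← Finset.mul_sum, Finset.sum_sub_distrib, ← Finset.mul_sum, EuclideanSpace.norm_sq_eq]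
  simp
  left; ring

/-- Strong maximum principle: a nonnegative function satisfying `Δ v ≤ K v` wherever it is small
vanishes identically as soon as it vanishes somewhere. -/
lemma eq_zero_of_coordLaplacian_le {v : EuclideanSpace ℝ (Fin N) → ℝ} (hv : ContDiff ℝ 2 v)
    (hv0 : ∀ x, 0 ≤ v x) {K σ : ℝ} (hK : 0 ≤ K) (hσ : 0 < σ)
    (hle : ∀ x, v x < σ → coordLaplacian v x ≤ K * v x)
    {x₀ : EuclideanSpace ℝ (Fin N)} (hx₀ : v x₀ = 0) (q : EuclideanSpace ℝ (Fin N)) :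
    v q = 0 := by
  by_contra hq
  have hZ : IsClosed {x | v x = 0} := isClosed_eq hv.continuous continuous_const
  obtain ⟨x₁, hx₁ : v x₁ = 0, hdist⟩ := hZ.exists_infDist_eq_dist ⟨x₀, hx₀⟩ q
  have hclosest : ∀ z, v z = 0 → ‖x₁ - q‖ ≤ ‖z - q‖ := fun z hz => by
    rw [← dist_eq_norm, ← dist_eq_norm, dist_comm x₁, dist_comm z, ← hdist]
    exact Metric.infDist_le_dist_of_mem hz
  have hr : 0 < ‖x₁ - q‖ := norm_pos_iff.2 (sub_ne_zero.2 fun h => hq (h ▸ hx₁))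
  set r := ‖x₁ - q‖
  set y := q + (1 / 2 : ℝ) • (x₁ - q)
  have hx₁y : ‖x₁ - y‖ = r / 2 := by
    have : x₁ - y = (1 / 2 : ℝ) • (x₁ - q) := by simp only [y]; module
    rw [this, norm_smul]; norm_num; ring
  have huniq : ∀ z, v z = 0 → ‖z - y‖ ≤ r / 2 → z = x₁ := fun z hz hzy => by
    have e1 : z - y = (z - q) - (1 / 2 : ℝ) • (x₁ - q) := by simp only [y]; module
    have e2 : z - x₁ = (z - q) - (x₁ - q) := by module
    have h1 : ‖z - y‖ ^ 2 ≤ (r / 2) ^ 2 := by gcongr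
    have h2 : r ^ 2 ≤ ‖z - q‖ ^ 2 := by gcongr; exact hclosest z hz
    have h3 := norm_sub_sq_real (z - q) (x₁ - q)
    rw [e1, norm_sub_sq_real, inner_smul_right, norm_smul, mul_pow] at h1
    rw [← e2] at h3
    norm_num at h1
    have h4 : ‖z - x₁‖ ^ 2 ≤ 0 := by
      change _ = _ - _ + r ^ 2 at h3
      change _ - _ + _ * r ^ 2 ≤ _ at h1
      linarith
    have h5 : ‖z - x₁‖ = 0 := by nlinarith [norm_nonneg (z - x₁)]
    exact sub_eq_zero.1 (norm_eq_zero.1 h5)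
  obtain ⟨m, hm, hmv⟩ : ∃ m, 0 < m ∧ ∀ x ∈ Metric.sphere x₁ (r / 4) ∩ Metric.closedBall y (r / 2),
      m ≤ v x := by
    refine ((isCompact_sphere x₁ (r / 4)).inter_right
      Metric.isClosed_closedBall).exists_forall_le' hv.continuous.continuousOn fun x hx => ?_
    refine lt_of_le_of_ne (hv0 x) fun h => ?_
    have := huniq x h.symm (by simpa [dist_eq_norm] using hx.2)
    have h4 := hx.1
    rw [this, Metric.mem_sphere, dist_self] at h4
    linarith
  set α : ℝ := max 1 (4 * (2 * N + K + 1) / r ^ 2)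
  have hα1 : 1 ≤ α := le_max_left _ _
  have hα : 2 * N + K + 1 ≤ α * r ^ 2 / 4 := by
    have : 4 * (2 * N + K + 1) / r ^ 2 ≤ α := le_max_right _ _
    rw [div_le_iff₀ (by positivity)] at this
    linarith
  set ε : ℝ := min m σ / 2
  have hε : 0 < ε := half_pos (lt_min hm hσ)
  have hεm : ε < m := (half_lt_self (lt_min hm hσ)).trans_le (min_le_left _ _)
  have hεσ : ε < σ := (half_lt_self (lt_min hm hσ)).trans_le (min_le_right _ _)
  set b : ℝ := Real.exp (-α * (r / 2) ^ 2)
  have hb : 0 < b := Real.exp_pos _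
  have hbarrier_lt : ∀ x, gaussianBarrier ε α b y x < ε := fun x => by
    have : Real.exp (-α * ‖x - y‖ ^ 2) ≤ 1 := Real.exp_le_one_iff.2 (by
      nlinarith [sq_nonneg ‖x - y‖])
    unfold gaussianBarrier
    nlinarith
  have hz : ContDiff ℝ 2 fun x => v x - gaussianBarrier ε α b y x :=
    hv.sub (contDiff_gaussianBarrier ε α b y)
  obtain ⟨p, hp, hpmin⟩ := (isCompact_closedBall x₁ (r / 4)).exists_isMinOn
    ⟨x₁, Metric.mem_closedBall_self (by positivity)⟩ hz.continuous.continuousOn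
  have hp0 : v p ≤ gaussianBarrier ε α b y p := by
    have := hpmin (Metric.mem_closedBall_self (x := x₁) (by positivity : 0 ≤ r / 4))
    simpa [hx₁, gaussianBarrier, hx₁y, b] using this
  have hp_ball : p ∈ Metric.ball x₁ (r / 4) := by
    refine lt_of_le_of_ne (Metric.mem_closedBall.1 hp) fun hsph => ?_
    rcases le_or_gt ‖p - y‖ (r / 2) with h | h
    · have := hmv p ⟨hsph, by simpa [dist_eq_norm] using h⟩
      linarith [hbarrier_lt p]
    · have hlt : Real.exp (-α * ‖p - y‖ ^ 2) < b := by
        apply Real.exp_lt_exp.2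
        have : (r / 2) ^ 2 < ‖p - y‖ ^ 2 := by gcongr
        nlinarith
      have : gaussianBarrier ε α b y p < 0 := mul_neg_of_pos_of_neg hε (by linarith)
      linarith [hv0 p]
  have hlap := coordLaplacian_nonneg_of_isLocalMin hz
    (hpmin.isLocalMin (Filter.mem_of_superset (Metric.isOpen_ball.mem_nhds hp_ball)
      Metric.ball_subset_closedBall))
  rw [coordLaplacian_sub hv (contDiff_gaussianBarrier ε α b y),
    coordLaplacian_gaussianBarrier] at hlap
  have hpy : r / 4 ≤ ‖p - y‖ := by
    have h1 : ‖x₁ - y‖ ≤ ‖x₁ - p‖ + ‖p - y‖ := norm_sub_le_norm_sub_add_norm_sub _ _ _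
    have h2 : ‖x₁ - p‖ < r / 4 := by
      rw [← dist_eq_norm, dist_comm]; exact hp_ball
    linarith
  have hcoef : K + 1 ≤ 4 * α ^ 2 * ‖p - y‖ ^ 2 - 2 * α * N := by
    have : (r / 4) ^ 2 ≤ ‖p - y‖ ^ 2 := by gcongr
    have h1 : 4 * α ^ 2 * (r / 4) ^ 2 ≤ 4 * α ^ 2 * ‖p - y‖ ^ 2 := by gcongr
    nlinarith [mul_le_mul_of_nonneg_left hα (by linarith : 0 ≤ α),
      mul_le_mul_of_nonneg_right hα1 (by linarith : 0 ≤ K + 1)]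
  have hE : 0 < ε * Real.exp (-α * ‖p - y‖ ^ 2) := by positivity
  have hvE : v p ≤ ε * Real.exp (-α * ‖p - y‖ ^ 2) := by
    unfold gaussianBarrier at hp0
    nlinarith
  have h1 := hle p (hp0.trans_lt ((hbarrier_lt p).trans hεσ))
  nlinarith [mul_le_mul_of_nonneg_left hvE hK, mul_le_mul_of_nonneg_left hcoef hE.le]

/-- Weak maximum principle for functions vanishing at infinity. -/
lemma nonneg_of_coordLaplacian_nonpos (hN : 1 ≤ N) {w : EuclideanSpace ℝ (Fin N) → ℝ}
    (hw : ContDiff ℝ 2 w) (hlim : Tendsto w (cocompact _) (nhds 0))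
    (hle : ∀ x, w x < 0 → coordLaplacian w x ≤ 0) (x : EuclideanSpace ℝ (Fin N)) : 0 ≤ w x := by
  have : Nonempty (Fin N) := ⟨⟨0, hN⟩⟩
  by_contra! hx
  obtain ⟨p, hp⟩ := hw.continuous.exists_forall_le' x
    ((hlim.eventually (lt_mem_nhds hx)).mono fun _ h => h.le)
  have hp0 : w p < 0 := (hp x).trans_lt hx
  have hconst : ∀ y, w y - w p = 0 :=
    eq_zero_of_coordLaplacian_le (hw.sub contDiff_const) (fun y => sub_nonneg.2 (hp y))
      le_rfl (neg_pos.2 hp0)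
      (fun y hy => by
        rw [coordLaplacian_sub_const, zero_mul]
        exact hle y (by linarith)) (sub_self (w p))
  obtain ⟨y, hy⟩ := (hlim.eventually (lt_mem_nhds hp0)).exists
  linarith [hconst y]

lemma exists_abs_le_of_tendsto_cocompact {u : EuclideanSpace ℝ (Fin N) → ℝ} (hu : Continuous u)
    (hlim : Tendsto u (cocompact _) (nhds 0)) : ∃ M, ∀ x, |u x| ≤ M := by
  obtain ⟨s, hs, hsu⟩ := mem_cocompact.1 (hlim.abs.eventually
    (gt_mem_nhds (by simp : |(0 : ℝ)| < 1)))
  obtain ⟨M, hM⟩ := hs.exists_bound_of_continuousOn hu.continuousOn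
  refine ⟨max M 1, fun x => ?_⟩
  by_cases hx : x ∈ s
  · exact (hM x hx).trans (le_max_left _ _)
  · exact (le_of_lt (hsu hx)).trans (le_max_right _ _)

/-- Two ordered localized solutions which touch somewhere coincide. -/
lemma eq_of_le_of_touching {f : ℝ → ℝ} (hf : ContDiff ℝ 1 f)
    {u v : EuclideanSpace ℝ (Fin N) → ℝ} (hu : ContDiff ℝ 2 u) (hv : ContDiff ℝ 2 v)
    (heu : ∀ x, coordLaplacian u x + f (u x) = 0) (hev : ∀ x, coordLaplacian v x + f (v x) = 0)
    (hlu : Tendsto u (cocompact _) (nhds 0)) (hlv : Tendsto v (cocompact _) (nhds 0))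
    (hle : ∀ x, v x ≤ u x) {x₀ : EuclideanSpace ℝ (Fin N)} (hx₀ : u x₀ = v x₀) : u = v := by
  obtain ⟨A, hA⟩ := exists_abs_le_of_tendsto_cocompact hu.continuous hlu
  obtain ⟨B, hB⟩ := exists_abs_le_of_tendsto_cocompact hv.continuous hlv
  obtain ⟨K, hK⟩ := (hf.locallyLipschitz.locallyLipschitzOn
    (s := Set.Icc (-max A B) (max A B))).exists_lipschitzOnWith_of_compact isCompact_Icc
  funext x
  refine sub_eq_zero.1 (eq_zero_of_coordLaplacian_le (hu.sub hv)
    (fun y => sub_nonneg.2 (hle y)) K.2 one_pos (fun y _ => ?_) (sub_eq_zero.2 hx₀) x)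
  rw [coordLaplacian_sub hu hv]
  have h := hK.dist_le_mul (u y) (abs_le.1 ((hA y).trans (le_max_left _ _)))
    (v y) (abs_le.1 ((hB y).trans (le_max_right _ _)))
  rw [Real.dist_eq, Real.dist_eq, abs_of_nonneg (sub_nonneg.2 (hle y))] at h
  have := neg_le_of_abs_le h
  change _ ≤ (K : ℝ) * _
  linarith [heu y, hev y]

lemma tendsto_comp_add_right_cocompact {v : EuclideanSpace ℝ (Fin N) → ℝ}
    (hlim : Tendsto v (cocompact _) (nhds 0)) (a : EuclideanSpace ℝ (Fin N)) :
    Tendsto (fun x => v (x + a)) (cocompact _) (nhds 0) :=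
  hlim.comp (Homeomorph.addRight a).isClosedEmbedding.tendsto_cocompact

/-- A localized function lying below one of its proper translates vanishes. -/
lemma eq_zero_of_le_translate {v : EuclideanSpace ℝ (Fin N) → ℝ}
    (hlim : Tendsto v (cocompact _) (nhds 0)) {a : EuclideanSpace ℝ (Fin N)} (ha : a ≠ 0)
    (hle : ∀ x, v x ≤ v (x + a)) (x : EuclideanSpace ℝ (Fin N)) : v x = 0 := by
  have hseq : ∀ b : EuclideanSpace ℝ (Fin N), b ≠ 0 →
      Tendsto (fun n : ℕ => v (x + (n : ℝ) • b)) atTop (nhds 0) := fun b hb => by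
    refine hlim.comp ?_
    rw [← Metric.cobounded_eq_cocompact, ← tendsto_norm_atTop_iff_cobounded]
    refine tendsto_atTop_mono (f := fun n : ℕ => (n : ℝ) * ‖b‖ - ‖x‖) (fun n => ?_)
      (tendsto_atTop_add_const_right _ _
        (tendsto_natCast_atTop_atTop.atTop_mul_const (norm_pos_iff.2 hb)))
    have := norm_sub_norm_le ((n : ℝ) • b) (-x)
    rw [norm_neg, sub_neg_eq_add, add_comm _ x, norm_smul, Real.norm_natCast] at this
    exact this
  have hup : Monotone fun n : ℕ => v (x + (n : ℝ) • a) := monotone_nat_of_le_succ fun n => by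
    have := hle (x + (n : ℝ) • a)
    have e : x + (n : ℝ) • a + a = x + ((n + 1 : ℕ) : ℝ) • a := by push_cast; module
    rwa [e] at this
  have hdown : Antitone fun n : ℕ => v (x + (n : ℝ) • -a) := antitone_nat_of_succ_le fun n => by
    have := hle (x + ((n + 1 : ℕ) : ℝ) • -a)
    have e : x + ((n + 1 : ℕ) : ℝ) • -a + a = x + (n : ℝ) • -a := by push_cast; module
    rwa [e] at this
  have h1 := hup.ge_of_tendsto (hseq a ha) 0
  have h2 := hdown.le_of_tendsto (hseq (-a) (neg_ne_zero.2 ha)) 0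
  simp only [Nat.cast_zero, zero_smul, add_zero] at h1 h2
  exact le_antisymm h1 h2

/-- If `v` lies strictly below `u`, then so do, weakly, all small perturbations of `v` by
translation. -/
lemma eventually_translate_le (hN : 1 ≤ N) {f : ℝ → ℝ} {δ : ℝ} (hδ : 0 < δ)
    (hf : AntitoneOn f (Set.Icc (-δ) δ))
    {u v : EuclideanSpace ℝ (Fin N) → ℝ} (hu : ContDiff ℝ 2 u) (hv : ContDiff ℝ 2 v)
    (heu : ∀ x, coordLaplacian u x + f (u x) = 0) (hev : ∀ x, coordLaplacian v x + f (v x) = 0)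
    (hlu : Tendsto u (cocompact _) (nhds 0)) (hlv : Tendsto v (cocompact _) (nhds 0))
    {a₀ : EuclideanSpace ℝ (Fin N)} (hlt : ∀ x, v (x + a₀) < u x) :
    ∀ᶠ a in nhds a₀, ∀ x, v (x + a) ≤ u x := by
  have hsmall : ∀ {w : EuclideanSpace ℝ (Fin N) → ℝ}, Tendsto w (cocompact _) (nhds 0) →
      ∃ R, ∀ x, R < ‖x‖ → w x ∈ Set.Icc (-δ) δ := fun hw => by
    obtain ⟨R, hR⟩ := Metric.closedBall_compl_subset_of_mem_cocompact
      (hw (Icc_mem_nhds (neg_lt_zero.2 hδ) hδ)) 0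
    exact ⟨R, fun x hx => hR (by simpa using hx)⟩
  obtain ⟨R₁, hR₁⟩ := hsmall hlu
  obtain ⟨R₂, hR₂⟩ := hsmall hlv
  set R := max R₁ (R₂ + ‖a₀‖ + 1)
  have hcore : ∀ᶠ a in nhds a₀, ∀ x ∈ Metric.closedBall (0 : EuclideanSpace ℝ (Fin N)) R,
      v (x + a) < u x := by
    refine (isCompact_closedBall 0 R).eventually_forall_of_forall_eventually fun x _ => ?_
    have hc : Continuous fun z : EuclideanSpace ℝ (Fin N) × EuclideanSpace ℝ (Fin N) =>
        v (z.2 + z.1) := hv.continuous.comp (by fun_prop)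
    exact (hc.tendsto (a₀, x)).eventually_lt
      ((hu.continuous.comp continuous_snd).tendsto (a₀, x)) (hlt x)
  filter_upwards [hcore, Metric.ball_mem_nhds a₀ one_pos] with a ha hball x
  have hva : ContDiff ℝ 2 fun x => v (x + a) := hv.comp (contDiff_id.add contDiff_const)
  refine sub_nonneg.1 (nonneg_of_coordLaplacian_nonpos hN (hu.sub hva)
    (by simpa using hlu.sub (tendsto_comp_add_right_cocompact hlv a)) (fun y hy => ?_) x)
  have hy : u y < v (y + a) := sub_neg.1 hy
  have hyR : R < ‖y‖ := by
    by_contra! h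
    exact lt_asymm hy (ha y (by simpa using h))
  have hau : ‖a‖ < ‖a₀‖ + 1 := by
    have := norm_sub_norm_le a a₀
    have h2 : ‖a - a₀‖ < 1 := by simpa [dist_eq_norm] using hball
    linarith
  have hy2 : R₂ < ‖y + a‖ := by
    have h1 := norm_sub_le (y + a) a
    rw [add_sub_cancel_right] at h1
    have h2 : R₂ + ‖a₀‖ + 1 ≤ R := le_max_right _ _
    linarith
  have hfle := hf (hR₁ y ((le_max_left _ _).trans_lt hyR)) (hR₂ _ hy2) hy.le
  rw [coordLaplacian_sub hu hva, coordLaplacian_comp_add_right]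
  linarith [heu y, hev (y + a)]

/-- Ordered distinct localized solutions remain ordered under arbitrary translations, hence their
signs are constant. -/
lemma sign_of_ordered (hN : 1 ≤ N) {f : ℝ → ℝ} (hf : ContDiff ℝ 1 f) {δ : ℝ} (hδ : 0 < δ)
    (hf' : AntitoneOn f (Set.Icc (-δ) δ))
    {u v : EuclideanSpace ℝ (Fin N) → ℝ} (hu : ContDiff ℝ 2 u) (hv : ContDiff ℝ 2 v)
    (heu : ∀ x, coordLaplacian u x + f (u x) = 0) (hev : ∀ x, coordLaplacian v x + f (v x) = 0)
    (hlu : Tendsto u (cocompact _) (nhds 0)) (hlv : Tendsto v (cocompact _) (nhds 0))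
    (hne : u ≠ v) (hle : ∀ x, v x ≤ u x) : (∀ x, 0 ≤ u x) ∧ ∀ x, v x ≤ 0 := by
  have : Nonempty (Fin N) := ⟨⟨0, hN⟩⟩
  set S := {a : EuclideanSpace ℝ (Fin N) | ∀ x, v (x + a) ≤ u x}
  have hclosed : IsClosed S := by
    simp only [S, Set.ofPred_forall]
    exact isClosed_iInter fun x =>
      isClosed_le (hv.continuous.comp (by fun_prop)) continuous_const
  have hopen : IsOpen S := by
    refine isOpen_iff_mem_nhds.2 fun a ha => ?_
    refine eventually_translate_le hN hδ hf' hu hv heu hev hlu hlv fun x =>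
      lt_of_le_of_ne (ha x) fun hx => hne ?_
    have heq : u = fun x => v (x + a) :=
      eq_of_le_of_touching hf hu (hv.comp (contDiff_id.add contDiff_const)) heu
        (fun x => by rw [coordLaplacian_comp_add_right]; exact hev (x + a)) hlu
        (tendsto_comp_add_right_cocompact hlv a) ha hx.symm
    rcases eq_or_ne a 0 with rfl | ha0
    · simpa using heq
    · have hv0 := eq_zero_of_le_translate hlv ha0 fun x => by
        simpa [heq] using hle x
      rw [heq]
      funext x
      rw [hv0, hv0]
  have huniv : S = Set.univ := IsClopen.eq_univ ⟨hclosed, hopen⟩ ⟨0, by simpa [S] using hle⟩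
  have hall : ∀ x z, v z ≤ u x := fun x z => by
    have : z - x ∈ S := huniv ▸ Set.mem_univ _
    simpa using this x
  exact ⟨fun x => le_of_tendsto' hlv (hall x), fun z => ge_of_tendsto' hlu fun x => hall x z⟩

end CoordLaplacian

theorem stmt_1 {N : ℕ} (hN : 1 ≤ N) (f : ℝ → ℝ) (hf : ContDiff ℝ 1 f) (hf0 : f 0 = 0)
    (δ : ℝ) (hδ : 0 < δ) (hf' : ∀ s : ℝ, |s| ≤ δ → deriv f s ≤ 0)
    (u₁ u₂ : EuclideanSpace ℝ (Fin N) → ℝ)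
    (hu₁ : ContDiff ℝ 2 u₁) (hu₂ : ContDiff ℝ 2 u₂)
    (heq₁ : ∀ x, coordLaplacian u₁ x + f (u₁ x) = 0)
    (heq₂ : ∀ x, coordLaplacian u₂ x + f (u₂ x) = 0)
    (hloc₁ : Tendsto u₁ (cocompact (EuclideanSpace ℝ (Fin N))) (nhds 0))
    (hloc₂ : Tendsto u₂ (cocompact (EuclideanSpace ℝ (Fin N))) (nhds 0))
    (hne : u₁ ≠ u₂)
    (hnt₁ : ∃ x, u₁ x ≠ 0) (hnt₂ : ∃ x, u₂ x ≠ 0)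
    (hsign : (∃ x, u₁ x > 0) ∧ (∃ y, u₁ y < 0) ∨ (∃ x, u₂ x > 0) ∧ (∃ y, u₂ y < 0)) :
    (∃ x, u₁ x > u₂ x) ∧ (∃ y, u₁ y < u₂ y) := by
  have hanti : AntitoneOn f (Set.Icc (-δ) δ) :=
    antitoneOn_of_deriv_nonpos (convex_Icc _ _) hf.continuous.continuousOn
      (hf.differentiable one_ne_zero).differentiableOn
      fun s hs => hf' s (abs_le.2 (Set.mem_Icc.1 (interior_subset hs)))
  constructor
  · by_contra! hle
    obtain ⟨h2, h1⟩ := sign_of_ordered hN hf hδ hanti hu₂ hu₁ heq₂ heq₁ hloc₂ hloc₁ hne.symm hle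
    rcases hsign with ⟨⟨x, hx⟩, -⟩ | ⟨-, ⟨y, hy⟩⟩
    · exact hx.not_ge (h1 x)
    · exact hy.not_ge (h2 y)
  · by_contra! hle
    obtain ⟨h1, h2⟩ := sign_of_ordered hN hf hδ hanti hu₁ hu₂ heq₁ heq₂ hloc₁ hloc₂ hne hle
    rcases hsign with ⟨-, ⟨y, hy⟩⟩ | ⟨⟨x, hx⟩, -⟩
    · exact hy.not_ge (h1 y)
    · exact hx.not_ge (h2 x)
end

section
/- Let N ≥ 1 and let f : ℝ → ℝ be continuously differentiable with f(0) = 0. If u : ℝ^N → ℝ is a classical solution of Δu + f(u) = 0 in ℝ^N with u(x) → 0 as |x| → ∞, then its gradient also decays: ∂u/∂x_i (x) → 0 as |x| → ∞ for every i = 1, …, N. -/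
open MeasureTheory Filter

/-- The second-derivative necessary condition at a local maximum. -/
lemma IsLocalMax.second_deriv_nonpos {g g' : ℝ → ℝ} {a x : ℝ} (hg : ∀ t, HasDerivAt g (g' t) t)
    (hg' : HasDerivAt g' a x) (h : IsLocalMax g x) : a ≤ 0 := by
  by_contra! ha
  have hderiv : deriv g = g' := funext fun t => (hg t).deriv
  have hmin : IsLocalMin g x := isLocalMin_of_deriv_deriv_pos
    (by rwa [hderiv, hg'.deriv]) h.deriv_eq_zero (hg x).continuousAt
  have hconst : g =ᶠ[nhds x] fun _ => g x := by
    filter_upwards [h, hmin] with t h₁ h₂ using le_antisymm h₁ h₂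
  have hzero : g' =ᶠ[nhds x] fun _ => (0 : ℝ) := by
    simpa [hderiv] using hconst.deriv
  have := hzero.deriv_eq
  rw [hg'.deriv, deriv_const] at this
  exact ha.ne' this

section Lines

variable {E : Type*} [NormedAddCommGroup E] [NormedSpace ℝ E] {u : E → ℝ}

lemma hasDerivAt_comp_line (hu : Differentiable ℝ u) (z e : E) (s t : ℝ) :
    HasDerivAt (fun t : ℝ => u (z + (s * t) • e)) (s * fderiv ℝ u (z + (s * t) • e) e) t := by
  have hline : HasDerivAt (fun t : ℝ => z + (s * t) • e) (s • e) t := by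
    simpa using (((hasDerivAt_id t).const_mul s).smul_const e).const_add z
  refine ((hu (z + (s * t) • e)).hasFDerivAt.comp_hasDerivAt t hline).congr_deriv ?_
  simp

lemma ContDiff.differentiable_fderiv_apply (hu : ContDiff ℝ 2 u) (e : E) :
    Differentiable ℝ fun y => fderiv ℝ u y e :=
  ((hu.fderiv_right (m := 1) (by norm_num)).clm_apply contDiff_const).differentiable (by norm_num)

end Lines

section GradientEstimate

variable {N : ℕ}

/-- Reflection in the `i`-th coordinate preserves the Euclidean norm. -/
lemma norm_sub_two_mul_coord_smul_single (i : Fin N) (y : EuclideanSpace ℝ (Fin N)) :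
    ‖y - (2 * y i) • EuclideanSpace.single i (1 : ℝ)‖ = ‖y‖ := by
  have h : ‖y - (2 * y i) • EuclideanSpace.single i (1 : ℝ)‖ ^ 2 = ‖y‖ ^ 2 := by
    rw [norm_sub_sq_real, inner_smul_right, EuclideanSpace.inner_single_right, norm_smul, mul_pow]
    simp only [conj_trivial, PiLp.norm_single, norm_one, Real.norm_eq_abs, sq_abs]
    ring
  exact (sq_eq_sq₀ (norm_nonneg _) (norm_nonneg _)).1 h

/-- Comparison of the odd part of `u` in the `i`-th variable with a quadratic barrier on a
half-ball. -/
lemma odd_part_le_barrier {u : EuclideanSpace ℝ (Fin N) → ℝ} (hu : ContDiff ℝ 2 u)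
    {x : EuclideanSpace ℝ (Fin N)} {M F : ℝ} (hF : 0 ≤ F)
    (hM : ∀ y, ‖y‖ ≤ 1 → |u (x + y)| ≤ M)
    (hlap : ∀ y, ‖y‖ ≤ 1 → |coordLaplacian u (x + y)| < F) (i : Fin N)
    {y : EuclideanSpace ℝ (Fin N)} (hy : ‖y‖ ≤ 1) (hyi : 0 ≤ y i) :
    (u (x + y) - u (x + (y - (2 * y i) • EuclideanSpace.single i (1 : ℝ)))) / 2 ≤
      M * ‖y‖ ^ 2 + (N * M + F / 2) * (y i * (1 - y i)) := by
  set R : EuclideanSpace ℝ (Fin N) → EuclideanSpace ℝ (Fin N) :=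
    fun y => y - (2 * y i) • EuclideanSpace.single i (1 : ℝ) with hR
  have hRnorm : ∀ y, ‖R y‖ = ‖y‖ := norm_sub_two_mul_coord_smul_single i
  set c : ℝ := N * M + F / 2 with hc
  have hM0 : 0 ≤ M := (abs_nonneg _).trans (hM 0 (by simp))
  have hc0 : 0 ≤ c := by positivity
  set w : EuclideanSpace ℝ (Fin N) → ℝ :=
    fun y => (u (x + y) - u (x + R y)) / 2 - (M * ‖y‖ ^ 2 + c * (y i * (1 - y i))) with hw
  set K : Set (EuclideanSpace ℝ (Fin N)) := Metric.closedBall 0 1 ∩ {y | 0 ≤ y i} with hK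
  have hcoord : Continuous fun y : EuclideanSpace ℝ (Fin N) => y i := by fun_prop
  have hKc : IsCompact K :=
    (isCompact_closedBall _ _).inter_right (isClosed_le continuous_const hcoord)
  have hucont := hu.continuous
  have hwc : Continuous w := by
    simp only [hw, hR]
    fun_prop
  have hyK : y ∈ K := ⟨by simpa using hy, hyi⟩
  suffices hmain : w y ≤ 0 by
    simp only [hw, hR] at hmain
    linarith
  obtain ⟨z, ⟨hz, hzi⟩, hzmax⟩ := hKc.exists_isMaxOn ⟨y, hyK⟩ hwc.continuousOn
  have hz1 : ‖z‖ ≤ 1 := by simpa using hz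
  have hzi' : 0 ≤ z i := hzi
  have hzile : z i ≤ 1 := (le_abs_self _).trans ((PiLp.norm_apply_le z i).trans hz1)
  refine (hzmax hyK).trans ?_
  show w z ≤ 0
  rcases hzi'.eq_or_lt with h0 | hpos
  · have : w z = -(M * ‖z‖ ^ 2) := by simp [hw, hR, ← h0]
    rw [this]
    have : 0 ≤ M * ‖z‖ ^ 2 := by positivity
    linarith
  rcases hz1.eq_or_lt with h1 | hlt
  · have hp := (abs_le.1 (hM z hz1)).2
    have hq := (abs_le.1 (hM (R z) ((hRnorm z).trans_le hz1))).1
    have : 0 ≤ c * (z i * (1 - z i)) := mul_nonneg hc0 (mul_nonneg hzi' (by linarith))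
    simp only [hw, h1]
    linarith
  exfalso
  have hloc : IsLocalMax w z := by
    have hopen : IsOpen (Metric.ball (0 : EuclideanSpace ℝ (Fin N)) 1 ∩ {y | 0 < y i}) :=
      Metric.isOpen_ball.inter (isOpen_lt continuous_const hcoord)
    filter_upwards [hopen.mem_nhds ⟨by simpa using hlt, hpos⟩] with v hv
    exact hzmax ⟨Metric.ball_subset_closedBall hv.1, le_of_lt (show 0 < v i from hv.2)⟩
  set D : Fin N → EuclideanSpace ℝ (Fin N) → ℝ := fun j p =>
    fderiv ℝ (fun y => fderiv ℝ u y (EuclideanSpace.single j 1)) p (EuclideanSpace.single j 1)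
    with hD
  have hsecond : ∀ j : Fin N, (D j (x + z) - D j (x + R z)) / 2 - 2 * M +
      (if j = i then 2 * c else 0) ≤ 0 := by
    intro j
    set e : EuclideanSpace ℝ (Fin N) := EuclideanSpace.single j 1 with he
    obtain ⟨δ, hδ, hδ2, hδe, hδs⟩ : ∃ δ : ℝ, e i = δ ∧ δ * δ = δ ∧
        δ • EuclideanSpace.single i (1 : ℝ) = δ • e ∧
        (if j = i then 2 * c else 0) = 2 * c * δ := by
      by_cases hji : j = i
      · exact ⟨1, by simp [he, hji], by simp, by simp [he, hji], by simp [hji]⟩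
      · exact ⟨0, by simp [he, Ne.symm hji], by simp, by simp, by simp [hji]⟩
    have hRline : ∀ t : ℝ, R (z + t • e) = R z + ((1 - 2 * δ) * t) • e := by
      intro t
      have h1 : (2 * (z i + t * δ)) • EuclideanSpace.single i (1 : ℝ) =
          (2 * z i) • EuclideanSpace.single i (1 : ℝ) + (2 * t) • (δ • e) := by
        rw [← hδe]; module
      simp only [hR, PiLp.add_apply, PiLp.smul_apply, smul_eq_mul, hδ, h1]
      module
    have hnorm : ∀ t : ℝ, ‖z + t • e‖ ^ 2 = ‖z‖ ^ 2 + 2 * t * z j + t ^ 2 := by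
      intro t
      rw [norm_add_sq_real, inner_smul_right, EuclideanSpace.inner_single_right, norm_smul, mul_pow]
      simp [he]
      ring
    have hline : ∀ t : ℝ, w (z + t • e) =
        (u (x + z + (1 * t) • e) - u (x + R z + ((1 - 2 * δ) * t) • e)) / 2 -
        (M * (‖z‖ ^ 2 + 2 * t * z j + t ^ 2) + c * ((z i + t * δ) * (1 - (z i + t * δ)))) := by
      intro t
      simp only [hw, hRline, hnorm, PiLp.add_apply, PiLp.smul_apply, smul_eq_mul, hδ, add_assoc,
        one_mul]
    have hdiff := hu.differentiable (by norm_num)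
    have hdiff' := hu.differentiable_fderiv_apply e
    have hfirst : ∀ t : ℝ, HasDerivAt (fun t : ℝ => w (z + t • e))
        ((1 * fderiv ℝ u (x + z + (1 * t) • e) e -
          (1 - 2 * δ) * fderiv ℝ u (x + R z + ((1 - 2 * δ) * t) • e) e) / 2 -
        (M * (2 * z j + 2 * t) + c * (δ * (1 - 2 * (z i + t * δ))))) t := by
      intro t
      rw [funext hline]
      have hl : HasDerivAt (fun t : ℝ => z i + t * δ) δ t := by
        simpa using ((hasDerivAt_id t).mul_const δ).const_add (z i)
      have hq : HasDerivAt (fun t : ℝ => ‖z‖ ^ 2 + 2 * t * z j + t ^ 2) (2 * z j + 2 * t) t := by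
        have h1 := (((hasDerivAt_id t).const_mul 2).mul_const (z j)).const_add (‖z‖ ^ 2)
        refine (h1.add (hasDerivAt_pow 2 t)).congr_deriv ?_
        simp
      refine (((hasDerivAt_comp_line hdiff _ e 1 t).sub
        (hasDerivAt_comp_line hdiff _ e (1 - 2 * δ) t)).div_const 2).sub
        ((hq.const_mul M).add ((hl.mul (hl.const_sub 1)).const_mul c)) |>.congr_deriv ?_
      ring
    have hderiv2 : HasDerivAt (fun t : ℝ => (1 * fderiv ℝ u (x + z + (1 * t) • e) e -
          (1 - 2 * δ) * fderiv ℝ u (x + R z + ((1 - 2 * δ) * t) • e) e) / 2 -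
        (M * (2 * z j + 2 * t) + c * (δ * (1 - 2 * (z i + t * δ)))))
        ((D j (x + z) - D j (x + R z)) / 2 - 2 * M + 2 * c * δ) 0 := by
      have hl : HasDerivAt (fun t : ℝ => z i + t * δ) δ 0 := by
        simpa using ((hasDerivAt_id (0 : ℝ)).mul_const δ).const_add (z i)
      have hq : HasDerivAt (fun t : ℝ => 2 * z j + 2 * t) 2 0 := by
        simpa using ((hasDerivAt_id (0 : ℝ)).const_mul 2).const_add (2 * z j)
      refine (((((hasDerivAt_comp_line hdiff' _ e 1 0).const_mul 1).sub
        ((hasDerivAt_comp_line hdiff' _ e (1 - 2 * δ) 0).const_mul (1 - 2 * δ))).div_const 2).sub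
        ((hq.const_mul M).add ((((hl.const_mul 2).const_sub 1).const_mul δ).const_mul c)))
        |>.congr_deriv ?_
      simp only [mul_zero, zero_smul, add_zero, hD]
      linear_combination (2 * c + 2 * fderiv ℝ (fun y => fderiv ℝ u y e) (x + R z) e * (-1)) * hδ2
    rw [hδs]
    refine IsLocalMax.second_deriv_nonpos hfirst hderiv2 ?_
    have hcont : ContinuousAt (fun t : ℝ => z + t • e) 0 := by fun_prop
    have hloc' : IsLocalMax w ((fun t : ℝ => z + t • e) 0) := by simpa using hloc
    exact hcont.eventually hloc' |>.mono fun t ht => by simpa using ht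
  have hsum := Finset.sum_nonpos fun j (_ : j ∈ Finset.univ) => hsecond j
  have hp := (abs_lt.1 (hlap z hz1)).1
  have hq := (abs_lt.1 (hlap (R z) ((hRnorm z).trans_le hz1))).2
  rw [Finset.sum_add_distrib, Finset.sum_sub_distrib, ← Finset.sum_div, Finset.sum_sub_distrib]
    at hsum
  simp only [Finset.sum_const, Finset.card_univ, Fintype.card_fin, nsmul_eq_mul,
    Finset.sum_ite_eq', Finset.mem_univ, if_true] at hsum
  change -F < ∑ j, D j (x + z) at hp
  change ∑ j, D j (x + R z) < F at hq
  rw [hc] at hsum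
  linarith

/-- One-sided interior gradient estimate on the unit ball. -/
lemma fderiv_single_le {u : EuclideanSpace ℝ (Fin N) → ℝ} (hu : ContDiff ℝ 2 u)
    {x : EuclideanSpace ℝ (Fin N)} {M F : ℝ} (hF : 0 ≤ F)
    (hM : ∀ y, ‖y‖ ≤ 1 → |u (x + y)| ≤ M)
    (hlap : ∀ y, ‖y‖ ≤ 1 → |coordLaplacian u (x + y)| < F) (i : Fin N) :
    fderiv ℝ u x (EuclideanSpace.single i 1) ≤ N * M + F / 2 := by
  set e : EuclideanSpace ℝ (Fin N) := EuclideanSpace.single i 1 with he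
  set c : ℝ := N * M + F / 2 with hc
  have hdiff := hu.differentiable (by norm_num)
  have hbound : ∀ t : ℝ, 0 ≤ t → t ≤ 1 →
      0 ≤ M * t ^ 2 + c * (t * (1 - t)) - (u (x + (1 * t) • e) - u (x + (-1 * t) • e)) / 2 := by
    intro t h0 h1
    have hn : ‖t • e‖ = t := by simp [he, norm_smul, abs_of_nonneg h0]
    have hi : (t • e) i = t := by simp [he]
    have := odd_part_le_barrier hu hF hM hlap i (y := t • e) (hn.trans_le h1) (h0.trans_eq hi.symm)
    have hrefl : t • e - (2 * t) • e = (-1 * t) • e := by module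
    rw [hn, hi, ← he, hrefl, ← hc] at this
    rw [one_mul]
    linarith
  have hd : HasDerivAt (fun t : ℝ => M * t ^ 2 + c * (t * (1 - t)) -
      (u (x + (1 * t) • e) - u (x + (-1 * t) • e)) / 2) (c - fderiv ℝ u x e) 0 := by
    refine ((((hasDerivAt_pow 2 (0 : ℝ)).const_mul M).add (((hasDerivAt_id (0 : ℝ)).mul
      ((hasDerivAt_id (0 : ℝ)).const_sub 1)).const_mul c)).sub
      (((hasDerivAt_comp_line hdiff x e 1 0).sub
        (hasDerivAt_comp_line hdiff x e (-1) 0)).div_const 2)) |>.congr_deriv ?_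
    simp
  have hmin : IsLocalMinOn (fun t : ℝ => M * t ^ 2 + c * (t * (1 - t)) -
      (u (x + (1 * t) • e) - u (x + (-1 * t) • e)) / 2) (Set.Icc 0 1) 0 := by
    refine IsMinOn.localize fun t ht => ?_
    simpa using hbound t ht.1 ht.2
  have hcone : (1 : ℝ) ∈ posTangentConeAt (Set.Icc (0 : ℝ) 1) 0 :=
    mem_posTangentConeAt_of_segment_subset (by simp [segment_eq_Icc])
  have := hmin.hasFDerivWithinAt_nonneg hd.hasFDerivAt.hasFDerivWithinAt hcone
  simp at this
  linarith

lemma coordLaplacian_neg (u : EuclideanSpace ℝ (Fin N) → ℝ) (x : EuclideanSpace ℝ (Fin N)) :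
    coordLaplacian (-u) x = -coordLaplacian u x := by
  simp only [coordLaplacian, ← Finset.sum_neg_distrib]
  refine Finset.sum_congr rfl fun i _ => ?_
  simp [fderiv_neg, fderiv_fun_neg]

/-- Interior gradient estimate for Poisson's equation on the unit ball. -/
lemma abs_fderiv_single_le {u : EuclideanSpace ℝ (Fin N) → ℝ} (hu : ContDiff ℝ 2 u)
    {x : EuclideanSpace ℝ (Fin N)} {M F : ℝ} (hF : 0 ≤ F)
    (hM : ∀ y, ‖y‖ ≤ 1 → |u (x + y)| ≤ M)
    (hlap : ∀ y, ‖y‖ ≤ 1 → |coordLaplacian u (x + y)| < F) (i : Fin N) :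
    |fderiv ℝ u x (EuclideanSpace.single i 1)| ≤ N * M + F / 2 := by
  refine abs_le'.2 ⟨fderiv_single_le hu hF hM hlap i, ?_⟩
  have := fderiv_single_le (u := -u) (x := x) hu.neg hF (by simpa using hM)
    (by simpa [coordLaplacian_neg] using hlap) i
  simpa [fderiv_neg] using this

end GradientEstimate

theorem stmt_6 {N : ℕ} (hN : 1 ≤ N) (f : ℝ → ℝ) (hf : ContDiff ℝ 1 f) (hf0 : f 0 = 0)
    (u : EuclideanSpace ℝ (Fin N) → ℝ) (hu : ContDiff ℝ 2 u)
    (heq : ∀ x, coordLaplacian u x + f (u x) = 0)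
    (hloc : Tendsto u (cocompact (EuclideanSpace ℝ (Fin N))) (nhds 0)) :
    ∀ i : Fin N,
      Tendsto (fun x => fderiv ℝ u x (EuclideanSpace.single i 1))
        (cocompact (EuclideanSpace ℝ (Fin N))) (nhds 0) := by
  intro i
  rw [Metric.tendsto_nhds]
  intro ε hε
  obtain ⟨η, hη, hηε⟩ : ∃ η : ℝ, 0 < η ∧ N * η + η / 2 < ε := by
    refine ⟨ε / (N + 1), by positivity, ?_⟩
    have h : (N + 1 : ℝ) * (ε / (N + 1)) = ε := by field_simp
    have hpos : 0 < ε / (N + 1 : ℝ) := by positivity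
    linarith
  have hfu : Tendsto (fun x => f (u x)) (cocompact (EuclideanSpace ℝ (Fin N))) (nhds 0) := by
    have := (hf.continuous.tendsto 0).comp hloc
    rwa [hf0] at this
  have hev : ∀ᶠ x in cocompact (EuclideanSpace ℝ (Fin N)), |u x| < η ∧ |f (u x)| < η := by
    filter_upwards [Metric.tendsto_nhds.1 hloc η hη, Metric.tendsto_nhds.1 hfu η hη] with x h₁ h₂
    simpa using And.intro h₁ h₂
  rw [← Metric.cobounded_eq_cocompact, ← comap_norm_atTop, eventually_comap,
    eventually_atTop] at hev ⊢
  obtain ⟨r, hr⟩ := hev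
  refine ⟨r + 1, fun b hb x hx => ?_⟩
  have hball : ∀ y, ‖y‖ ≤ 1 → |u (x + y)| < η ∧ |f (u (x + y))| < η := by
    intro y hy
    refine hr ‖x + y‖ ?_ (x + y) rfl
    have := norm_sub_le_norm_add x y
    linarith
  have hgrad := abs_fderiv_single_le hu hη.le (fun y hy => (hball y hy).1.le)
    (fun y hy => by
      rw [eq_neg_of_add_eq_zero_left (heq (x + y)), abs_neg]
      exact (hball y hy).2) i
  simpa using hgrad.trans_lt hηε
end
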